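/- Let $y^1, \dots, y^M \in \mathbb{C}^m$ with $m \ge 10$ be nonzero vectors forming a tight frame, i.e., $\sum_{i=1}^M |\langle a, y^i \rangle|^2 = A \|a\|_2^2$ for some $A > 0$ and all $a \in \mathbb{C}^m$, and suppose $M \ge \lceil b' m \rceil$ for some $b' \ge 1 + \frac{10}{m}$. Let $p, t \in (0,1)$ and set $n := \lceil \frac{3}{t^2} m \log(\frac{2m}{p}) \rceil$. Draw $n$ indices $j_1, \dots, j_n$ i.i.d. according to $\varrho_i = \|y^i\|_2^2 / \sum_k \|y^k\|_2^2$. Then with probability exceeding $1 - p$ there exists a subset $J' \subseteq \{j_1, \dots, j_n\}$ (without duplicates) with $|J'| \le \lceil b' m \rceil$ such that for all $a \in \mathbb{C}^m$: $\frac{(1-t)(b'-1)^3}{432\, b'^3} \|a\|_2^2 \le \sum_{i \in J'} \left| \left\langle a, \frac{y^i}{\|y^i\|_2} \right\rangle \right|^2 \le (1+t) \left\lceil \frac{3 \log(2m/p)}{t^2} \right\rceil \|a\|_2^2$. -/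

import Mathlib

open MeasureTheory Matrix

section LieProduct

open NormedSpace Filter Topology

variable {𝔸 : Type*} [NormedRing 𝔸]

theorem norm_normedSpace_exp_le [NormedAlgebra ℝ 𝔸] [NormOneClass 𝔸] (x : 𝔸) :
    ‖exp x‖ ≤ Real.exp ‖x‖ := by
  rw [NormedSpace.exp_eq_tsum ℝ]
  refine tsum_of_norm_bounded (g := fun n : ℕ => (n.factorial : ℝ)⁻¹ • ‖x‖ ^ n) ?_ fun n => ?_
  · rw [Real.exp_eq_exp_ℝ]
    exact exp_series_hasSum_exp' (𝕂 := ℝ) ‖x‖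
  · rw [norm_smul, norm_inv, Real.norm_natCast, smul_eq_mul]
    gcongr
    exact norm_pow_le x n

theorem norm_pow_sub_pow_le_of_norm_le [NormOneClass 𝔸] {x y : 𝔸} {c : ℝ} (hx : ‖x‖ ≤ c)
    (hy : ‖y‖ ≤ c) (hc : 1 ≤ c) (n : ℕ) : ‖x ^ n - y ^ n‖ ≤ n * ‖x - y‖ * c ^ n := by
  induction n with
  | zero => simp
  | succ n ih =>
    have hsplit : x ^ (n + 1) - y ^ (n + 1) = x ^ n * (x - y) + (x ^ n - y ^ n) * y := by
      rw [pow_succ, pow_succ]; noncomm_ring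
    have hxn : ‖x ^ n‖ ≤ c ^ (n + 1) :=
      (norm_pow_le x n).trans ((pow_le_pow_left₀ (norm_nonneg x) hx n).trans
        (pow_le_pow_right₀ hc n.le_succ))
    calc ‖x ^ (n + 1) - y ^ (n + 1)‖
        ≤ ‖x ^ n‖ * ‖x - y‖ + ‖x ^ n - y ^ n‖ * ‖y‖ := by
          rw [hsplit]
          exact (norm_add_le _ _).trans (add_le_add (norm_mul_le _ _) (norm_mul_le _ _))
      _ ≤ c ^ (n + 1) * ‖x - y‖ + (n * ‖x - y‖ * c ^ n) * c := by gcongr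
      _ = (n + 1 : ℕ) * ‖x - y‖ * c ^ (n + 1) := by push_cast; ring

/-- The Lie product formula, along the powers of two. -/
theorem tendsto_exp_mul_exp_pow [NormedAlgebra ℝ 𝔸] [CompleteSpace 𝔸] [NormOneClass 𝔸]
    (a b : 𝔸) :
    Tendsto (fun j : ℕ => (exp ((2 ^ j : ℝ)⁻¹ • a) * exp ((2 ^ j : ℝ)⁻¹ • b)) ^ (2 ^ j)) atTop
      (𝓝 (exp (a + b))) := by
  set f : ℝ → 𝔸 := fun s => exp (s • (a + b)) - exp (s • a) * exp (s • b) with hf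
  have hderiv : HasDerivAt f 0 0 := by
    have h := (hasDerivAt_exp_smul_const (𝕂 := ℝ) (a + b) 0).sub
      ((hasDerivAt_exp_smul_const (𝕂 := ℝ) a 0).mul (hasDerivAt_exp_smul_const (𝕂 := ℝ) b 0))
    exact h.congr_deriv (by simp)
  have hlim : Tendsto (fun j : ℕ => (2 ^ j : ℝ) * ‖f ((2 ^ j : ℝ)⁻¹)‖) atTop (𝓝 0) := by
    have hseq : Tendsto (fun j : ℕ => (2 ^ j : ℝ)⁻¹) atTop (𝓝[≠] 0) := by
      refine tendsto_nhdsWithin_iff.2 ⟨?_, Eventually.of_forall fun j => by simp⟩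
      exact (tendsto_pow_atTop_atTop_of_one_lt (one_lt_two)).inv_tendsto_atTop
    have h := ((hasDerivAt_iff_tendsto_slope.1 hderiv).comp hseq).norm
    simpa [slope_def_module, hf, norm_smul, Function.comp_def] using h
  rw [tendsto_iff_norm_sub_tendsto_zero]
  have hbound : ∀ j : ℕ, ‖(exp ((2 ^ j : ℝ)⁻¹ • a) * exp ((2 ^ j : ℝ)⁻¹ • b)) ^ (2 ^ j)
      - exp (a + b)‖ ≤ ((2 ^ j : ℝ) * ‖f ((2 ^ j : ℝ)⁻¹)‖) * Real.exp (‖a‖ + ‖b‖) := by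
    intro j
    set s : ℝ := (2 ^ j : ℝ)⁻¹ with hs
    have hs0 : 0 < s := by positivity
    have hexp : exp (a + b) = exp (s • (a + b)) ^ (2 ^ j) := by
      let _ : NormedAlgebra ℚ 𝔸 := NormedAlgebra.restrictScalars ℚ ℝ 𝔸
      rw [← NormedSpace.exp_nsmul, ← Nat.cast_smul_eq_nsmul ℝ, smul_smul]
      simp [hs]
    have hx : ‖exp (s • (a + b))‖ ≤ Real.exp (s * (‖a‖ + ‖b‖)) := by
      refine (norm_normedSpace_exp_le _).trans (Real.exp_le_exp.2 ?_)
      rw [norm_smul, Real.norm_of_nonneg hs0.le]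
      gcongr
      exact norm_add_le a b
    have hy : ‖exp (s • a) * exp (s • b)‖ ≤ Real.exp (s * (‖a‖ + ‖b‖)) := by
      refine (norm_mul_le _ _).trans ?_
      rw [mul_add, Real.exp_add]
      gcongr
      · exact (norm_normedSpace_exp_le _).trans_eq
          (by rw [norm_smul, Real.norm_of_nonneg hs0.le])
      · exact (norm_normedSpace_exp_le _).trans_eq
          (by rw [norm_smul, Real.norm_of_nonneg hs0.le])
    have h := norm_pow_sub_pow_le_of_norm_le hx hy (Real.one_le_exp (by positivity)) (2 ^ j)
    rw [norm_sub_rev, hexp]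
    refine h.trans_eq ?_
    rw [← Real.exp_nat_mul, ← mul_assoc]
    simp [hs, hf]
  exact squeeze_zero (fun _ => norm_nonneg _) hbound (by simpa using hlim.mul_const _)

end LieProduct

section GoldenThompson

open scoped ComplexOrder

variable {d : Type*} [Fintype d]

theorem trace_mul_pow_comm [DecidableEq d] (X Y : Matrix d d ℂ) (k : ℕ) :
    ((X * Y) ^ k).trace = ((Y * X) ^ k).trace := by
  cases k with
  | zero => simp
  | succ k => rw [pow_succ, ← mul_assoc, mul_pow_mul, mul_assoc, trace_mul_comm, mul_assoc,
      ← pow_succ]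

theorem re_trace_mul_conjTranspose_self_nonneg (M : Matrix d d ℂ) :
    0 ≤ (M * Mᴴ).trace.re :=
  (Complex.le_def.1 (posSemidef_self_mul_conjTranspose M).trace_nonneg).1

theorem re_trace_conjTranspose (M : Matrix d d ℂ) : Mᴴ.trace.re = M.trace.re := by
  simp [trace_conjTranspose]

theorem re_trace_mul_self_le (M : Matrix d d ℂ) : (M * M).trace.re ≤ (M * Mᴴ).trace.re := by
  have h := re_trace_mul_conjTranspose_self_nonneg (M - Mᴴ)
  have hstar : (Mᴴ * Mᴴ).trace.re = (M * M).trace.re := by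
    rw [← conjTranspose_mul, re_trace_conjTranspose]
  have hexp : (M - Mᴴ) * (M - Mᴴ)ᴴ = M * Mᴴ - M * M - Mᴴ * Mᴴ + Mᴴ * M := by
    simp only [conjTranspose_sub, conjTranspose_conjTranspose]
    noncomm_ring
  rw [hexp, trace_add, trace_sub, trace_sub, trace_mul_comm Mᴴ M] at h
  simp only [Complex.add_re, Complex.sub_re] at h
  linarith

theorem re_trace_mul_le_of_isHermitian [DecidableEq d] {P Q : Matrix d d ℂ} (hP : P.IsHermitian)
    (hQ : Q.IsHermitian) :
    (P * Q).trace.re ≤ ((P ^ 2).trace.re + (Q ^ 2).trace.re) / 2 := by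
  have h := re_trace_mul_conjTranspose_self_nonneg (P - Q)
  have hexp : (P - Q) * (P - Q)ᴴ = P ^ 2 - P * Q - Q * P + Q ^ 2 := by
    rw [conjTranspose_sub, hP.eq, hQ.eq]
    noncomm_ring
  rw [hexp, trace_add, trace_sub, trace_sub, trace_mul_comm Q P] at h
  simp only [Complex.add_re, Complex.sub_re] at h
  linarith

theorem re_trace_pow_two_pow_le [DecidableEq d] (j : ℕ) :
    (∀ M : Matrix d d ℂ, (M ^ 2 ^ (j + 1)).trace.re ≤ ((M * Mᴴ) ^ 2 ^ j).trace.re) ∧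
    ∀ A B : Matrix d d ℂ, A.IsHermitian → B.IsHermitian →
      ((A * B) ^ 2 ^ j).trace.re ≤ (A ^ 2 ^ j * B ^ 2 ^ j).trace.re := by
  induction j with
  | zero => exact ⟨fun M => by simpa [pow_two] using re_trace_mul_self_le M, by simp⟩
  | succ j ih =>
    obtain ⟨ihM, ihAB⟩ := ih
    refine ⟨fun M => ?_, fun A B hA hB => ?_⟩
    · have hP : (M * Mᴴ).IsHermitian := isHermitian_mul_conjTranspose_self M
      have hQ : (Mᴴ * M).IsHermitian := isHermitian_conjTranspose_mul_self M
      calc (M ^ 2 ^ (j + 1 + 1)).trace.re = ((M ^ 2) ^ 2 ^ (j + 1)).trace.re := by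
            rw [← pow_mul, ← pow_succ']
        _ ≤ ((M ^ 2 * (M ^ 2)ᴴ) ^ 2 ^ j).trace.re := ihM _
        _ = ((M * (M * Mᴴ * Mᴴ)) ^ 2 ^ j).trace.re := by
            simp only [pow_two, conjTranspose_mul, mul_assoc]
        _ = ((M * Mᴴ * (Mᴴ * M)) ^ 2 ^ j).trace.re := by
            rw [trace_mul_pow_comm, mul_assoc]
        _ ≤ ((M * Mᴴ) ^ 2 ^ j * (Mᴴ * M) ^ 2 ^ j).trace.re := ihAB _ _ hP hQ
        _ ≤ (((M * Mᴴ) ^ 2 ^ (j + 1)).trace.re + ((Mᴴ * M) ^ 2 ^ (j + 1)).trace.re) / 2 := by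
            simpa only [← pow_mul, ← pow_succ] using
              re_trace_mul_le_of_isHermitian (hP.pow (2 ^ j)) (hQ.pow (2 ^ j))
        _ = ((M * Mᴴ) ^ 2 ^ (j + 1)).trace.re := by
            rw [trace_mul_pow_comm Mᴴ M]; ring
    · calc ((A * B) ^ 2 ^ (j + 1)).trace.re ≤ ((A * B * (A * B)ᴴ) ^ 2 ^ j).trace.re := ihM _
        _ = ((A * (B ^ 2 * A)) ^ 2 ^ j).trace.re := by
            rw [conjTranspose_mul, hA.eq, hB.eq]; simp only [pow_two, mul_assoc]
        _ = ((B ^ 2 * A ^ 2) ^ 2 ^ j).trace.re := by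
            rw [trace_mul_pow_comm, mul_assoc, pow_two A]
        _ ≤ ((B ^ 2) ^ 2 ^ j * (A ^ 2) ^ 2 ^ j).trace.re := ihAB _ _ (hB.pow 2) (hA.pow 2)
        _ = (A ^ 2 ^ (j + 1) * B ^ 2 ^ (j + 1)).trace.re := by
            rw [trace_mul_comm, ← pow_mul, ← pow_mul, ← pow_succ']

open scoped Matrix.Norms.Operator in
theorem tendsto_matrix_exp_mul_exp_pow [DecidableEq d] [Nonempty d] (A B : Matrix d d ℂ) :
    Filter.Tendsto (fun j : ℕ => (NormedSpace.exp ((2 ^ j : ℝ)⁻¹ • A) *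
      NormedSpace.exp ((2 ^ j : ℝ)⁻¹ • B)) ^ (2 ^ j)) Filter.atTop
      (nhds (NormedSpace.exp (A + B))) :=
  tendsto_exp_mul_exp_pow A B

/-- The Golden–Thompson inequality. -/
theorem re_trace_exp_add_le [DecidableEq d] [Nonempty d] {A B : Matrix d d ℂ} (hA : A.IsHermitian)
    (hB : B.IsHermitian) :
    (NormedSpace.exp (A + B)).trace.re ≤ (NormedSpace.exp A * NormedSpace.exp B).trace.re := by
  have hcont : Continuous fun M : Matrix d d ℂ => M.trace.re :=
    Complex.continuous_re.comp continuous_id.matrix_trace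
  refine le_of_tendsto ((hcont.tendsto _).comp (tendsto_matrix_exp_mul_exp_pow A B))
    (Filter.Eventually.of_forall fun j => ?_)
  have hroot : ∀ C : Matrix d d ℂ,
      NormedSpace.exp ((2 ^ j : ℝ)⁻¹ • C) ^ 2 ^ j = NormedSpace.exp C := fun C => by
    rw [← Matrix.exp_nsmul, ← Nat.cast_smul_eq_nsmul ℝ, smul_smul]
    simp
  have hherm : ∀ C : Matrix d d ℂ, C.IsHermitian →
      (NormedSpace.exp ((2 ^ j : ℝ)⁻¹ • C)).IsHermitian := fun C hC =>
    IsHermitian.exp (hC.smul (IsSelfAdjoint.all _))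
  have h := (re_trace_pow_two_pow_le j).2 _ _ (hherm A hA) (hherm B hB)
  rwa [hroot, hroot] at h

end GoldenThompson

section Quadratic

variable {d : Type*} [Fintype d]

/-- The real part of the sesquilinear form `a ↦ ⟨a, A a⟩` of a matrix. -/
noncomputable def reForm (A : Matrix d d ℂ) (a : d → ℂ) : ℝ := (star a ⬝ᵥ A *ᵥ a).re

/-- The rank-one matrix `v v*`. -/
def rankOne (v : d → ℂ) : Matrix d d ℂ := vecMulVec v (star v)

theorem reForm_add (A B : Matrix d d ℂ) (a : d → ℂ) :
    reForm (A + B) a = reForm A a + reForm B a := by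
  simp [reForm, add_mulVec]

theorem reForm_sub (A B : Matrix d d ℂ) (a : d → ℂ) :
    reForm (A - B) a = reForm A a - reForm B a := by
  simp [reForm, sub_mulVec]

theorem reForm_smul (r : ℝ) (A : Matrix d d ℂ) (a : d → ℂ) :
    reForm (r • A) a = r * reForm A a := by
  simp [reForm, smul_mulVec]

theorem reForm_sum {ι : Type*} (s : Finset ι) (A : ι → Matrix d d ℂ) (a : d → ℂ) :
    reForm (∑ i ∈ s, A i) a = ∑ i ∈ s, reForm (A i) a := by
  classical
  induction s using Finset.induction_on with
  | empty => simp [reForm]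
  | insert i s hi ih => rw [Finset.sum_insert hi, Finset.sum_insert hi, reForm_add, ih]

theorem star_dotProduct_self_re (a : d → ℂ) : (star a ⬝ᵥ a).re = ∑ i, ‖a i‖ ^ 2 := by
  simp [dotProduct, ← Complex.normSq_eq_norm_sq, Complex.normSq_apply]

theorem sum_norm_sq_pos {a : d → ℂ} (ha : a ≠ 0) : 0 < ∑ i, ‖a i‖ ^ 2 := by
  obtain ⟨i, hi⟩ := Function.ne_iff.1 ha
  exact Finset.sum_pos' (fun _ _ => sq_nonneg _)
    ⟨i, Finset.mem_univ i, pow_pos (norm_pos_iff.2 hi) 2⟩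

theorem reForm_one [DecidableEq d] (a : d → ℂ) :
    reForm (1 : Matrix d d ℂ) a = ∑ i, ‖a i‖ ^ 2 := by
  rw [reForm, one_mulVec, star_dotProduct_self_re]

theorem reForm_rankOne (v a : d → ℂ) : reForm (rankOne v) a = ‖star v ⬝ᵥ a‖ ^ 2 := by
  rw [reForm, rankOne, vecMulVec_mulVec, dotProduct_smul, star_dotProduct a v,
    op_smul_eq_smul, smul_eq_mul, ← Complex.normSq_eq_norm_sq, ← starRingEnd_apply (star v ⬝ᵥ a),
    Complex.mul_conj, Complex.ofReal_re]

theorem rankOne_isHermitian {d : Type*} (v : d → ℂ) : (rankOne v).IsHermitian := by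
  rw [IsHermitian, rankOne, conjTranspose_vecMulVec, star_star]

theorem rankOne_mul_self {v : d → ℂ} (hv : ∑ i, ‖v i‖ ^ 2 = 1) :
    rankOne v * rankOne v = rankOne v := by
  have h : star v ⬝ᵥ v = 1 := by
    have him : (star v ⬝ᵥ v).im = 0 := by simp [dotProduct, mul_comm]
    exact Complex.ext (by rw [star_dotProduct_self_re, hv, Complex.one_re]) him
  rw [rankOne, vecMulVec_mul_vecMulVec, h, one_smul]

end Quadratic

section Diagonalization

variable {d : Type*} [Fintype d] [DecidableEq d]

theorem exists_diagonalization {A : Matrix d d ℂ} (hA : A.IsHermitian) :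
    ∃ (U : Matrix d d ℂ) (x : d → ℝ), Uᴴ * U = 1 ∧ U * Uᴴ = 1 ∧
      A = U * diagonal (fun i => (x i : ℂ)) * Uᴴ := by
  refine ⟨hA.eigenvectorUnitary, hA.eigenvalues, ?_, ?_, ?_⟩
  · exact Unitary.coe_star_mul_self _
  · exact Unitary.coe_mul_star_self _
  · exact hA.spectral_theorem

theorem reForm_conj_diagonal (U : Matrix d d ℂ) (x : d → ℝ) (a : d → ℂ) :
    reForm (U * diagonal (fun i => (x i : ℂ)) * Uᴴ) a = ∑ i, x i * ‖(Uᴴ *ᵥ a) i‖ ^ 2 := by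
  have h : star a ⬝ᵥ (U * diagonal (fun i => (x i : ℂ)) * Uᴴ) *ᵥ a =
      star (Uᴴ *ᵥ a) ⬝ᵥ diagonal (fun i => (x i : ℂ)) *ᵥ (Uᴴ *ᵥ a) := by
    rw [star_mulVec, conjTranspose_conjTranspose, ← dotProduct_mulVec, mulVec_mulVec,
      mulVec_mulVec, mul_assoc]
  rw [reForm, h]
  simp only [dotProduct, mulVec_diagonal, Complex.re_sum, Pi.star_apply]
  refine Finset.sum_congr rfl fun i _ => ?_
  generalize (Uᴴ *ᵥ a) i = z
  rw [← Complex.normSq_eq_norm_sq, Complex.normSq_apply]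
  simp
  ring

theorem sum_norm_sq_conjTranspose_mulVec {U : Matrix d d ℂ} (hU : U * Uᴴ = 1) (a : d → ℂ) :
    ∑ i, ‖(Uᴴ *ᵥ a) i‖ ^ 2 = ∑ i, ‖a i‖ ^ 2 := by
  have h := reForm_conj_diagonal U (fun _ => 1) a
  simp only [Complex.ofReal_one, diagonal_one, mul_one, hU, reForm_one, one_mul] at h
  exact h.symm

theorem trace_conj_diagonal {U : Matrix d d ℂ} (hU : Uᴴ * U = 1) (x : d → ℂ) :
    (U * diagonal x * Uᴴ).trace = ∑ i, x i := by
  rw [trace_mul_comm, ← mul_assoc, hU, one_mul, trace_diagonal]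

theorem exp_conj_diagonal {U : Matrix d d ℂ} (hU : Uᴴ * U = 1) (x : d → ℝ) :
    NormedSpace.exp (U * diagonal (fun i => (x i : ℂ)) * Uᴴ) =
      U * diagonal (fun i => ((Real.exp (x i) : ℝ) : ℂ)) * Uᴴ := by
  have hinv : U⁻¹ = Uᴴ := inv_eq_left_inv hU
  have hunit : IsUnit U := IsUnit.of_mul_eq_one_right _ hU
  rw [← hinv, Matrix.exp_conj _ _ hunit, Matrix.exp_diagonal]
  congr 3
  ext i
  rw [Pi.coe_exp, ← Complex.exp_eq_exp_ℂ, Complex.ofReal_exp]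

theorem re_trace_exp_nonneg {A : Matrix d d ℂ} (hA : A.IsHermitian) :
    0 ≤ (NormedSpace.exp A).trace.re := by
  obtain ⟨U, x, hU, -, rfl⟩ := exists_diagonalization hA
  rw [exp_conj_diagonal hU, trace_conj_diagonal hU, ← Complex.ofReal_sum, Complex.ofReal_re]
  exact Finset.sum_nonneg fun i _ => (Real.exp_pos _).le

theorem reForm_le_of_re_trace_exp_le {A : Matrix d d ℂ} (hA : A.IsHermitian) {c : ℝ}
    (hc : (NormedSpace.exp A).trace.re ≤ Real.exp c) (a : d → ℂ) :
    reForm A a ≤ c * ∑ i, ‖a i‖ ^ 2 := by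
  obtain ⟨U, x, hU, hU', rfl⟩ := exists_diagonalization hA
  rw [exp_conj_diagonal hU, trace_conj_diagonal hU, ← Complex.ofReal_sum, Complex.ofReal_re] at hc
  rw [reForm_conj_diagonal, ← sum_norm_sq_conjTranspose_mulVec hU', Finset.mul_sum]
  refine Finset.sum_le_sum fun i _ => ?_
  gcongr
  refine Real.exp_le_exp.1 (le_trans ?_ hc)
  exact Finset.single_le_sum (f := fun i => Real.exp (x i))
    (fun i _ => (Real.exp_pos _).le) (Finset.mem_univ i)

end Diagonalization

section MatrixChernoff

theorem exp_smul_of_isIdempotentElem {𝔸 : Type*} [NormedRing 𝔸] [NormedAlgebra ℝ 𝔸]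
    [CompleteSpace 𝔸] {P : 𝔸} (hP : IsIdempotentElem P) (r : ℝ) :
    NormedSpace.exp (r • P) = 1 + (Real.exp r - 1) • P := by
  have hreal : HasSum (fun n : ℕ => ((n.factorial : ℝ)⁻¹ • r ^ n) • P) (Real.exp r • P) := by
    have h := NormedSpace.exp_series_hasSum_exp' (𝕂 := ℝ) r
    rw [← Real.exp_eq_exp_ℝ] at h
    exact h.smul_const P
  have hzero : HasSum (fun n : ℕ => if n = 0 then 1 - P else 0) (1 - P) := hasSum_ite_eq 0 (1 - P)
  refine (NormedSpace.exp_series_hasSum_exp' (𝕂 := ℝ) (r • P)).unique ?_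
  convert hreal.add hzero using 1
  · funext n
    cases n with
    | zero => simp
    | succ n => simp [smul_pow, hP.pow_succ_eq, smul_smul]
  · rw [sub_smul, one_smul]; abel

open scoped Matrix.Norms.Operator in
theorem matrix_exp_smul_of_isIdempotentElem {d : Type*} [Fintype d] [DecidableEq d]
    {P : Matrix d d ℂ} (hP : IsIdempotentElem P) (r : ℝ) :
    NormedSpace.exp (r • P) = 1 + (Real.exp r - 1) • P :=
  exp_smul_of_isIdempotentElem hP r

variable {d : Type*} [Fintype d]

theorem re_trace_smul (r : ℝ) (A : Matrix d d ℂ) : (r • A).trace.re = r * A.trace.re := by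
  simp [trace_smul]

theorem sum_prod_mul_re_trace_exp_le [DecidableEq d] [Nonempty d] {ι : Type*} [Fintype ι] {ρ : ι → ℝ}
    (hρ : ∀ i, 0 ≤ ρ i) (hsum : ∑ i, ρ i = 1) {X : ι → Matrix d d ℂ}
    (hX : ∀ i, (X i).IsHermitian) (hX2 : ∀ i, IsIdempotentElem (X i)) {τ : ℝ} (hτ : τ ≤ 1)
    (hτ0 : 0 ≤ τ) (hmean : ∑ i, ρ i • X i = τ • 1) (r : ℝ) (n : ℕ) {K : Matrix d d ℂ}
    (hK : K.IsHermitian) :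
    ∑ j : Fin n → ι, (∏ k, ρ (j k)) * (NormedSpace.exp (K + r • ∑ k, X (j k))).trace.re ≤
      (1 + (Real.exp r - 1) * τ) ^ n * (NormedSpace.exp K).trace.re := by
  have hq : 0 ≤ 1 + (Real.exp r - 1) * τ := by nlinarith [Real.exp_pos r]
  have hherm : ∀ i, (r • X i).IsHermitian := fun i => (hX i).smul (IsSelfAdjoint.all r)
  induction n generalizing K with
  | zero => simp
  | succ n ih =>
    have hstep : ∑ i, ρ i * (NormedSpace.exp (K + r • X i)).trace.re ≤
        (1 + (Real.exp r - 1) * τ) * (NormedSpace.exp K).trace.re := by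
      calc ∑ i, ρ i * (NormedSpace.exp (K + r • X i)).trace.re
          ≤ ∑ i, ρ i * (NormedSpace.exp K * NormedSpace.exp (r • X i)).trace.re := by
            refine Finset.sum_le_sum fun i _ => mul_le_mul_of_nonneg_left ?_ (hρ i)
            exact re_trace_exp_add_le hK (hherm i)
        _ = (NormedSpace.exp K * ∑ i, ρ i • NormedSpace.exp (r • X i)).trace.re := by
            rw [Finset.mul_sum, trace_sum, Complex.re_sum]
            refine Finset.sum_congr rfl fun i _ => ?_
            rw [mul_smul_comm, re_trace_smul]
        _ = (1 + (Real.exp r - 1) * τ) * (NormedSpace.exp K).trace.re := by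
            have h : ∑ i, ρ i • NormedSpace.exp (r • X i) =
                (1 + (Real.exp r - 1) * τ) • (1 : Matrix d d ℂ) := by
              simp only [matrix_exp_smul_of_isIdempotentElem (hX2 _), smul_add, Finset.sum_add_distrib]
              rw [← Finset.sum_smul, hsum, add_smul, mul_smul, ← hmean, Finset.smul_sum]
              simp only [smul_comm (Real.exp r - 1)]
            rw [h, mul_smul_comm, mul_one, re_trace_smul]
    calc ∑ j : Fin (n + 1) → ι,
          (∏ k, ρ (j k)) * (NormedSpace.exp (K + r • ∑ k, X (j k))).trace.re
        = ∑ i, ρ i * ∑ j : Fin n → ι, (∏ k, ρ (j k)) *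
            (NormedSpace.exp ((K + r • X i) + r • ∑ k, X (j k))).trace.re := by
          rw [← (Fin.consEquiv fun _ : Fin (n + 1) => ι).sum_comp, Fintype.sum_prod_type]
          refine Finset.sum_congr rfl fun i _ => ?_
          rw [Finset.mul_sum]
          refine Finset.sum_congr rfl fun j _ => ?_
          simp [Fin.consEquiv, Fin.prod_univ_succ, Fin.sum_univ_succ, mul_assoc, add_assoc]
      _ ≤ ∑ i, ρ i * ((1 + (Real.exp r - 1) * τ) ^ n *
            (NormedSpace.exp (K + r • X i)).trace.re) := by
          gcongr with i
          · exact hρ i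
          · exact ih (hK.add (hherm i))
      _ = (1 + (Real.exp r - 1) * τ) ^ n *
            ∑ i, ρ i * (NormedSpace.exp (K + r • X i)).trace.re := by
          rw [Finset.mul_sum]
          exact Finset.sum_congr rfl fun i _ => by ring
      _ ≤ (1 + (Real.exp r - 1) * τ) ^ (n + 1) * (NormedSpace.exp K).trace.re := by
          rw [pow_succ, mul_assoc]
          gcongr

open Classical in
/-- Matrix Chernoff bound for sums of independent random projections. -/
theorem sum_prod_filter_le_of_mean [DecidableEq d] [Nonempty d] {ι : Type*} [Fintype ι] {ρ : ι → ℝ}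
    (hρ : ∀ i, 0 ≤ ρ i) (hsum : ∑ i, ρ i = 1) {X : ι → Matrix d d ℂ}
    (hX : ∀ i, (X i).IsHermitian) (hX2 : ∀ i, IsIdempotentElem (X i)) {τ : ℝ} (hτ : τ ≤ 1)
    (hτ0 : 0 ≤ τ) (hmean : ∑ i, ρ i • X i = τ • 1) (r c : ℝ) (n : ℕ) :
    ∑ j : Fin n → ι with ¬ ∀ a, r * reForm (∑ k, X (j k)) a ≤ c * ∑ i, ‖a i‖ ^ 2,
        ∏ k, ρ (j k) ≤
      Fintype.card d * Real.exp ((Real.exp r - 1) * τ * n - c) := by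
  have hw : ∀ j : Fin n → ι, 0 ≤ ∏ k, ρ (j k) := fun j => Finset.prod_nonneg fun k _ => hρ _
  have hherm : ∀ j : Fin n → ι, (r • ∑ k, X (j k)).IsHermitian := fun j =>
    IsHermitian.smul (isSelfAdjoint_sum _ fun k _ => hX (j k)) (IsSelfAdjoint.all r)
  have hpow : (1 + (Real.exp r - 1) * τ) ^ n ≤ Real.exp ((Real.exp r - 1) * τ * n) := by
    rw [mul_comm _ (n : ℝ), Real.exp_nat_mul]
    gcongr
    · nlinarith [Real.exp_pos r]
    · linarith [Real.add_one_le_exp ((Real.exp r - 1) * τ)]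
  have hmain := sum_prod_mul_re_trace_exp_le hρ hsum hX hX2 hτ hτ0 hmean r n
    (isHermitian_zero (n := d) (α := ℂ))
  simp only [zero_add, NormedSpace.exp_zero, trace_one, Complex.natCast_re] at hmain
  calc ∑ j : Fin n → ι with ¬ ∀ a, r * reForm (∑ k, X (j k)) a ≤ c * ∑ i, ‖a i‖ ^ 2,
        ∏ k, ρ (j k)
      ≤ ∑ j : Fin n → ι with ¬ ∀ a, r * reForm (∑ k, X (j k)) a ≤ c * ∑ i, ‖a i‖ ^ 2,
        (∏ k, ρ (j k)) * (NormedSpace.exp (r • ∑ k, X (j k))).trace.re * Real.exp (-c) := by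
        refine Finset.sum_le_sum fun j hj => ?_
        have hlt : Real.exp c ≤ (NormedSpace.exp (r • ∑ k, X (j k))).trace.re := by
          by_contra! hlt
          refine (Finset.mem_filter.1 hj).2 fun a => ?_
          rw [← reForm_smul]
          exact reForm_le_of_re_trace_exp_le (hherm j) hlt.le a
        have h1 : 1 ≤ (NormedSpace.exp (r • ∑ k, X (j k))).trace.re * Real.exp (-c) := by
          calc (1 : ℝ) = Real.exp c * Real.exp (-c) := by rw [← Real.exp_add]; simp
            _ ≤ _ := by gcongr
        rw [mul_assoc]
        exact le_mul_of_one_le_right (hw j) h1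
    _ ≤ ∑ j : Fin n → ι,
        (∏ k, ρ (j k)) * (NormedSpace.exp (r • ∑ k, X (j k))).trace.re * Real.exp (-c) := by
        refine Finset.sum_le_sum_of_subset_of_nonneg (Finset.filter_subset _ _) fun j _ _ => ?_
        exact mul_nonneg (mul_nonneg (hw j) (re_trace_exp_nonneg (hherm j))) (Real.exp_pos _).le
    _ ≤ Real.exp ((Real.exp r - 1) * τ * n) * Fintype.card d * Real.exp (-c) := by
        rw [← Finset.sum_mul]
        gcongr
        exact hmain.trans (by gcongr)
    _ = Fintype.card d * Real.exp ((Real.exp r - 1) * τ * n - c) := by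
        rw [sub_eq_add_neg _ c, Real.exp_add]; ring

end MatrixChernoff

section SpectralFunctions

variable {d : Type*} [Fintype d] [DecidableEq d]

/-- The matrix `U f U*`, where `f` is a real diagonal matrix. -/
def conjDiag (U : Matrix d d ℂ) (f : d → ℝ) : Matrix d d ℂ :=
  U * diagonal (fun i => (f i : ℂ)) * Uᴴ

theorem conjDiag_mul {U : Matrix d d ℂ} (hU : Uᴴ * U = 1) (f g : d → ℝ) :
    conjDiag U f * conjDiag U g = conjDiag U fun i => f i * g i := by
  calc conjDiag U f * conjDiag U g
      = U * diagonal (fun i => (f i : ℂ)) * (Uᴴ * U) * diagonal (fun i => (g i : ℂ)) * Uᴴ := by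
        simp only [conjDiag, mul_assoc]
    _ = conjDiag U fun i => f i * g i := by
        rw [hU, mul_one, mul_assoc U, diagonal_mul_diagonal]
        simp [conjDiag]

theorem conjDiag_const {U : Matrix d d ℂ} (hU : U * Uᴴ = 1) (r : ℝ) :
    conjDiag U (fun _ => r) = r • 1 := by
  have h : (diagonal fun _ => (r : ℂ) : Matrix d d ℂ) = r • 1 := by
    ext i j; by_cases hij : i = j <;> simp [hij, one_apply]
  rw [conjDiag, h, mul_smul_comm, mul_one, smul_mul_assoc, hU]

theorem conjDiag_sub (U : Matrix d d ℂ) (f g : d → ℝ) :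
    conjDiag U f - conjDiag U g = conjDiag U fun i => f i - g i := by
  rw [conjDiag, conjDiag, conjDiag, ← sub_mul, ← mul_sub, diagonal_sub]
  simp

theorem conjDiag_isHermitian (U : Matrix d d ℂ) (f : d → ℝ) : (conjDiag U f).IsHermitian := by
  refine isHermitian_mul_mul_conjTranspose U ?_
  rw [isHermitian_diagonal_iff]
  exact fun i => Complex.conj_ofReal _

theorem re_trace_conjDiag {U : Matrix d d ℂ} (hU : Uᴴ * U = 1) (f : d → ℝ) :
    (conjDiag U f).trace.re = ∑ i, f i := by
  rw [conjDiag, trace_conj_diagonal hU, ← Complex.ofReal_sum, Complex.ofReal_re]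

theorem reForm_conjDiag (U : Matrix d d ℂ) (f : d → ℝ) (a : d → ℂ) :
    reForm (conjDiag U f) a = ∑ i, f i * ‖(Uᴴ *ᵥ a) i‖ ^ 2 :=
  reForm_conj_diagonal U f a

theorem conjDiag_mul_inv {U : Matrix d d ℂ} (hU : Uᴴ * U = 1) (hU' : U * Uᴴ = 1) {f : d → ℝ}
    (hf : ∀ i, f i ≠ 0) : conjDiag U f * conjDiag U (fun i => (f i)⁻¹) = 1 := by
  rw [conjDiag_mul hU]
  simp only [mul_inv_cancel₀ (hf _)]
  rw [conjDiag_const hU', one_smul]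

theorem conjDiag_inv {U : Matrix d d ℂ} (hU : Uᴴ * U = 1) (hU' : U * Uᴴ = 1) {f : d → ℝ}
    (hf : ∀ i, f i ≠ 0) : (conjDiag U f)⁻¹ = conjDiag U fun i => (f i)⁻¹ :=
  inv_eq_right_inv (conjDiag_mul_inv hU hU' hf)

theorem conjTranspose_mulVec_ne_zero {U : Matrix d d ℂ} (hU : U * Uᴴ = 1) {a : d → ℂ}
    (ha : a ≠ 0) : Uᴴ *ᵥ a ≠ 0 := by
  intro h
  apply ha
  rw [← one_mulVec a, ← hU, ← mulVec_mulVec, h, mulVec_zero]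

theorem reForm_conjDiag_pos {U : Matrix d d ℂ} (hU : U * Uᴴ = 1) {f : d → ℝ}
    (hf : ∀ i, 0 < f i) {a : d → ℂ} (ha : a ≠ 0) : 0 < reForm (conjDiag U f) a := by
  obtain ⟨i, hi⟩ := Function.ne_iff.1 (conjTranspose_mulVec_ne_zero hU ha)
  rw [reForm_conjDiag]
  refine Finset.sum_pos' (fun j _ => mul_nonneg (hf j).le (sq_nonneg _)) ⟨i, Finset.mem_univ i, ?_⟩
  exact mul_pos (hf i) (pow_pos (norm_pos_iff.2 hi) 2)

theorem reForm_conjDiag_mulVec_single {U : Matrix d d ℂ} (hU : Uᴴ * U = 1) (f : d → ℝ) (i : d) :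
    reForm (conjDiag U f) (U *ᵥ Pi.single i 1) = f i := by
  rw [reForm_conjDiag, mulVec_mulVec, hU, one_mulVec, Finset.sum_eq_single i]
  · simp
  · intro j _ hj; simp [hj]
  · simp

theorem pos_of_reForm_conjDiag_pos {U : Matrix d d ℂ} (hU : Uᴴ * U = 1) {f : d → ℝ}
    (hf : ∀ a ≠ 0, 0 < reForm (conjDiag U f) a) (i : d) : 0 < f i := by
  rw [← reForm_conjDiag_mulVec_single hU f i]
  refine hf _ fun h => ?_
  have hUi : Uᴴ *ᵥ (U *ᵥ Pi.single i 1) = Pi.single i 1 := by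
    rw [mulVec_mulVec, hU, one_mulVec]
  rw [h, mulVec_zero] at hUi
  simpa using congrFun hUi i

theorem eq_smul_one_of_reForm {S : Matrix d d ℂ} (hS : S.IsHermitian) {r : ℝ}
    (h : ∀ a, reForm S a = r * ∑ i, ‖a i‖ ^ 2) : S = r • 1 := by
  obtain ⟨U, x, hU, hU', hSx⟩ := exists_diagonalization hS
  change S = conjDiag U x at hSx
  have hx : x = fun _ => r := by
    ext i
    have h1 := h (U *ᵥ Pi.single i 1)
    have h2 := reForm_conjDiag_mulVec_single hU (fun _ => (1 : ℝ)) i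
    rw [conjDiag_const hU', one_smul, reForm_one] at h2
    rwa [hSx, reForm_conjDiag_mulVec_single hU, h2, mul_one] at h1
  rw [hSx, hx, conjDiag_const hU']

theorem norm_dotProduct_sq_le_conjDiag {U : Matrix d d ℂ} (hU : U * Uᴴ = 1) {f : d → ℝ}
    (hf : ∀ i, 0 < f i) (v a : d → ℂ) :
    ‖star v ⬝ᵥ a‖ ^ 2 ≤
      reForm (conjDiag U fun i => (f i)⁻¹) v * reForm (conjDiag U f) a := by
  have hdot : star v ⬝ᵥ a = star (Uᴴ *ᵥ v) ⬝ᵥ (Uᴴ *ᵥ a) := by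
    rw [star_mulVec, conjTranspose_conjTranspose, ← dotProduct_mulVec, mulVec_mulVec, hU,
      one_mulVec]
  rw [hdot, reForm_conjDiag, reForm_conjDiag]
  have hnorm : ‖star (Uᴴ *ᵥ v) ⬝ᵥ (Uᴴ *ᵥ a)‖ ≤ ∑ i, ‖(Uᴴ *ᵥ v) i‖ * ‖(Uᴴ *ᵥ a) i‖ := by
    refine (norm_sum_le _ _).trans_eq ?_
    simp
  refine (pow_le_pow_left₀ (norm_nonneg _) hnorm 2).trans ?_
  refine Finset.sum_sq_le_sum_mul_sum_of_sq_le_mul _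
    (fun i _ => mul_nonneg (inv_nonneg.2 (hf i).le) (sq_nonneg _))
    (fun i _ => mul_nonneg (hf i).le (sq_nonneg _)) fun i _ => le_of_eq ?_
  have := (hf i).ne'
  field_simp

end SpectralFunctions

section RankOneUpdate

variable {d : Type*} [Fintype d]

theorem rankOne_mul_mul_rankOne {R : Matrix d d ℂ} (hR : R.IsHermitian) (v : d → ℂ) :
    rankOne v * R * rankOne v = reForm R v • rankOne v := by
  have hreal : star v ⬝ᵥ R *ᵥ v = (reForm R v : ℂ) := by
    have h : star (star v ⬝ᵥ R *ᵥ v) = star v ⬝ᵥ R *ᵥ v := by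
      have h' := star_dotProduct v (R *ᵥ v)
      rw [star_mulVec, hR.eq, ← dotProduct_mulVec] at h'
      exact h'.symm
    exact (Complex.conj_eq_iff_re.1 h).symm
  rw [rankOne, vecMulVec_mul, vecMulVec_mul_vecMulVec, ← dotProduct_mulVec, hreal]
  ext i j
  simp [vecMulVec_apply, mul_left_comm]

theorem reForm_eq_re_trace (M : Matrix d d ℂ) (v : d → ℂ) :
    reForm M v = (M * rankOne v).trace.re := by
  rw [rankOne, mul_vecMulVec, trace_vecMulVec, dotProduct_comm, reForm]

/-- The trace form of the Sherman–Morrison formula. -/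
theorem re_trace_inv_add_smul_rankOne [DecidableEq d] {P R : Matrix d d ℂ} (hPR : P * R = 1)
    (hR : R.IsHermitian) (v : d → ℂ) {s : ℝ} (hs : 1 + s * reForm R v ≠ 0) :
    (P + s • rankOne v)⁻¹.trace.re =
      R.trace.re - s / (1 + s * reForm R v) * reForm (R * R) v := by
  set k := reForm R v with hk
  have hinv : (P + s • rankOne v)⁻¹ = R - (s / (1 + s * k)) • (R * rankOne v * R) := by
    refine inv_eq_right_inv ?_
    have h1 : P * (R * rankOne v * R) = rankOne v * R := by
      rw [mul_assoc R, ← mul_assoc P, hPR, one_mul]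
    have h2 : rankOne v * (R * rankOne v * R) = k • (rankOne v * R) := by
      rw [← mul_assoc, ← mul_assoc, rankOne_mul_mul_rankOne hR, smul_mul_assoc]
    rw [add_mul, mul_sub, mul_sub, hPR, mul_smul_comm, h1, smul_mul_assoc, smul_mul_assoc,
      mul_smul_comm, h2, smul_smul, smul_smul, sub_add_sub_comm, ← add_smul, add_sub_assoc,
      ← sub_smul]
    rw [show s - (s / (1 + s * k) + s * (s / (1 + s * k)) * k) = 0 by field_simp; ring]
    simp
  rw [hinv, trace_sub, Complex.sub_re, re_trace_smul, mul_assoc, trace_mul_comm, mul_assoc,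
    trace_mul_comm, ← reForm_eq_re_trace]

end RankOneUpdate

section BarrierScalars

variable {d : Type*} [Fintype d]

theorem lt_of_sum_inv_lt {x : d → ℝ} {δ : ℝ} (hδ : 0 < δ) (hx : ∀ i, 0 < x i)
    (hsum : ∑ i, (x i)⁻¹ < δ⁻¹) (i : d) : δ < x i := by
  refine (inv_lt_inv₀ (hx i) hδ).1 (lt_of_le_of_lt ?_ hsum)
  exact Finset.single_le_sum (f := fun i => (x i)⁻¹) (fun j _ => (inv_pos.2 (hx j)).le)
    (Finset.mem_univ i)

theorem lower_barrier_scalar [Nonempty d] {x : d → ℝ} {δ : ℝ} (hδ : 0 < δ) (hx : ∀ i, 0 < x i)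
    (hsum : ∑ i, (x i)⁻¹ < δ⁻¹) :
    ∑ i, (x i)⁻¹ < ∑ i, (x i - δ)⁻¹ ∧
    (∑ i, (x i - δ)⁻¹ - ∑ i, (x i)⁻¹) * (δ⁻¹ + (∑ i, (x i - δ)⁻¹ - ∑ i, (x i)⁻¹)) ≤
      ∑ i, (x i - δ)⁻¹ * (x i - δ)⁻¹ := by
  have hlt := lt_of_sum_inv_lt hδ hx hsum
  have hy : ∀ i, 0 < x i - δ := fun i => sub_pos.2 (hlt i)
  have hD : ∑ i, (x i - δ)⁻¹ - ∑ i, (x i)⁻¹ = δ * ∑ i, (x i)⁻¹ * (x i - δ)⁻¹ := by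
    rw [← Finset.sum_sub_distrib, Finset.mul_sum]
    refine Finset.sum_congr rfl fun i _ => ?_
    have := (hx i).ne'
    have := (hy i).ne'
    field_simp
    ring
  have hpos : 0 < ∑ i, (x i)⁻¹ * (x i - δ)⁻¹ :=
    Finset.sum_pos (fun i _ => mul_pos (inv_pos.2 (hx i)) (inv_pos.2 (hy i))) Finset.univ_nonempty
  refine ⟨by nlinarith [mul_pos hδ hpos], ?_⟩
  have hcs : (∑ i, (x i)⁻¹ * (x i - δ)⁻¹) ^ 2 ≤
      (∑ i, (x i)⁻¹) * ∑ i, (x i)⁻¹ * ((x i - δ)⁻¹ * (x i - δ)⁻¹) := by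
    refine Finset.sum_sq_le_sum_mul_sum_of_sq_le_mul _ (fun i _ => (inv_pos.2 (hx i)).le)
      (fun i _ => mul_nonneg (inv_pos.2 (hx i)).le (mul_self_nonneg _)) fun i _ => le_of_eq (by ring)
  have hthird : ∑ i, (x i - δ)⁻¹ * (x i - δ)⁻¹ = ∑ i, (x i)⁻¹ * (x i - δ)⁻¹ +
      δ * ∑ i, (x i)⁻¹ * ((x i - δ)⁻¹ * (x i - δ)⁻¹) := by
    rw [Finset.mul_sum, ← Finset.sum_add_distrib]
    refine Finset.sum_congr rfl fun i _ => ?_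
    have := (hx i).ne'
    have := (hy i).ne'
    field_simp
    ring
  have hT : 0 ≤ ∑ i, (x i)⁻¹ * ((x i - δ)⁻¹ * (x i - δ)⁻¹) :=
    Finset.sum_nonneg fun i _ => mul_nonneg (inv_pos.2 (hx i)).le (mul_self_nonneg _)
  have hsum' : δ * ∑ i, (x i)⁻¹ ≤ 1 := by
    have := mul_le_mul_of_nonneg_left hsum.le hδ.le
    rwa [mul_inv_cancel₀ hδ.ne'] at this
  rw [hD, hthird]
  calc δ * (∑ i, (x i)⁻¹ * (x i - δ)⁻¹) * (δ⁻¹ + δ * ∑ i, (x i)⁻¹ * (x i - δ)⁻¹)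
      = ∑ i, (x i)⁻¹ * (x i - δ)⁻¹ + δ ^ 2 * (∑ i, (x i)⁻¹ * (x i - δ)⁻¹) ^ 2 := by
        field_simp
    _ ≤ ∑ i, (x i)⁻¹ * (x i - δ)⁻¹ + δ ^ 2 * ((∑ i, (x i)⁻¹) *
          ∑ i, (x i)⁻¹ * ((x i - δ)⁻¹ * (x i - δ)⁻¹)) := by gcongr
    _ ≤ _ := by nlinarith [mul_le_mul_of_nonneg_right hsum' (mul_nonneg hδ.le hT)]

theorem upper_barrier_scalar [Nonempty d] {y : d → ℝ} {δ : ℝ} (hδ : 0 < δ) (hy : ∀ i, 0 < y i) :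
    ∑ i, (y i + δ)⁻¹ < ∑ i, (y i)⁻¹ ∧
    ∑ i, (y i + δ)⁻¹ * (y i + δ)⁻¹ ≤ (∑ i, (y i)⁻¹ - ∑ i, (y i + δ)⁻¹) * δ⁻¹ := by
  refine ⟨Finset.sum_lt_sum_of_nonempty Finset.univ_nonempty fun i _ => ?_, ?_⟩
  · exact inv_strictAnti₀ (hy i) (by linarith)
  · rw [← Finset.sum_sub_distrib, Finset.sum_mul]
    refine Finset.sum_le_sum fun i _ => ?_
    have h0 := hy i
    have h1 : ((y i)⁻¹ - (y i + δ)⁻¹) * δ⁻¹ = (y i)⁻¹ * (y i + δ)⁻¹ := by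
      field_simp
      ring
    rw [h1]
    gcongr
    linarith

end BarrierScalars

section BarrierMethod

variable {d ι : Type*} [Fintype d] [DecidableEq d] [Fintype ι]

/-- The spectrum of `A` lies in `(l, u)`, and the lower and upper barrier potentials are at most
`εL` and `εU`. -/
structure IsBarrierState (A : Matrix d d ℂ) (l u εL εU : ℝ) : Prop where
  isHermitian : A.IsHermitian
  lower_pos : ∀ a ≠ 0, 0 < reForm (A - l • 1) a
  upper_pos : ∀ a ≠ 0, 0 < reForm (u • 1 - A) a
  lower_trace : (A - l • 1)⁻¹.trace.re ≤ εL
  upper_trace : (u • 1 - A)⁻¹.trace.re ≤ εU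

theorem sum_mul_reForm_eq_re_trace {c : ι → ℝ} {v : ι → d → ℂ}
    (hv : ∑ i, c i • rankOne (v i) = 1) (M : Matrix d d ℂ) :
    ∑ i, c i * reForm M (v i) = M.trace.re := by
  simp only [reForm_eq_re_trace, ← re_trace_smul]
  rw [← Complex.re_sum, ← trace_sum]
  simp only [← mul_smul_comm]
  rw [← Matrix.mul_sum, hv, mul_one]

theorem exists_pos_ne_zero_of_sum_eq_one [Nonempty d] {c : ι → ℝ} {v : ι → d → ℂ}
    (hc : ∀ i, 0 ≤ c i) (hv : ∑ i, c i • rankOne (v i) = 1) : ∃ i, 0 < c i ∧ v i ≠ 0 := by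
  by_contra! h
  have h0 : ∀ i, c i • rankOne (v i) = 0 := fun i => by
    rcases (hc i).eq_or_lt with h' | h'
    · rw [← h', zero_smul]
    · rw [h i h']; ext; simp [rankOne]
  rw [Finset.sum_eq_zero fun i _ => h0 i] at hv
  exact zero_ne_one hv

theorem exists_le_of_sum_mul_le [Nonempty d] {c : ι → ℝ} {v : ι → d → ℂ}
    (hc : ∀ i, 0 ≤ c i) (hv : ∑ i, c i • rankOne (v i) = 1) {f g : (d → ℂ) → ℝ}
    (hf : f 0 = 0) (hg : g 0 = 0) (hfg : ∑ i, c i * f (v i) ≤ ∑ i, c i * g (v i)) :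
    ∃ i, 0 < c i ∧ v i ≠ 0 ∧ f (v i) ≤ g (v i) := by
  by_contra! h
  refine hfg.not_gt (Finset.sum_lt_sum (fun i _ => ?_) ?_)
  · rcases (hc i).eq_or_lt with h' | h'
    · simp [← h']
    · by_cases hvi : v i = 0
      · simp [hvi, hf, hg]
      · exact mul_le_mul_of_nonneg_left (h i h' hvi).le h'.le
  · obtain ⟨i, hi, hvi⟩ := exists_pos_ne_zero_of_sum_eq_one hc hv
    exact ⟨i, Finset.mem_univ i, mul_lt_mul_of_pos_left (h i hi hvi) hi⟩

theorem conjDiag_sub_smul_one {U : Matrix d d ℂ} (hU : U * Uᴴ = 1) (x : d → ℝ) (l : ℝ) :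
    conjDiag U x - l • 1 = conjDiag U fun i => x i - l := by
  rw [← conjDiag_const hU, conjDiag_sub]

theorem smul_one_sub_conjDiag {U : Matrix d d ℂ} (hU : U * Uᴴ = 1) (x : d → ℝ) (u : ℝ) :
    u • 1 - conjDiag U x = conjDiag U fun i => u - x i := by
  rw [← conjDiag_const hU, conjDiag_sub]

theorem reForm_zero_right {d : Type*} [Fintype d] (M : Matrix d d ℂ) : reForm M 0 = 0 := by simp [reForm]

set_option maxHeartbeats 1000000 in
theorem exists_barrier_step [Nonempty d] {c : ι → ℝ} {v : ι → d → ℂ} (hc : ∀ i, 0 ≤ c i)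
    (hv : ∑ i, c i • rankOne (v i) = 1) {A : Matrix d d ℂ} {l u εL εU δL δU : ℝ}
    (hA : IsBarrierState A l u εL εU) (hδL : 0 < δL) (hδU : 0 < δU) (hεL : εL < δL⁻¹)
    (hbal : δU⁻¹ + εU ≤ δL⁻¹ - εL) :
    ∃ (i : ι) (s : ℝ), 0 < c i ∧ 0 < s ∧
      IsBarrierState (A + s • rankOne (v i)) (l + δL) (u + δU) εL εU := by
  obtain ⟨hherm, hlpos, hupos, hltr, hutr⟩ := hA
  obtain ⟨U, x, hU, hU', hAx⟩ := exists_diagonalization hherm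
  change A = conjDiag U x at hAx
  subst hAx
  rw [conjDiag_sub_smul_one hU'] at hlpos hltr
  rw [smul_one_sub_conjDiag hU'] at hupos hutr
  have hl := pos_of_reForm_conjDiag_pos hU hlpos
  have hu := pos_of_reForm_conjDiag_pos hU hupos
  rw [conjDiag_inv hU hU' fun i => (hl i).ne', re_trace_conjDiag hU] at hltr
  rw [conjDiag_inv hU hU' fun i => (hu i).ne', re_trace_conjDiag hU] at hutr
  have hlδ := lt_of_sum_inv_lt hδL hl (hltr.trans_lt hεL)
  obtain ⟨hD, hD2⟩ := lower_barrier_scalar hδL hl (hltr.trans_lt hεL)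
  obtain ⟨hE, hE2⟩ := upper_barrier_scalar hδU hu
  set y : d → ℝ := fun i => x i - l - δL with hy
  set z : d → ℝ := fun i => u - x i + δU with hz
  have hypos : ∀ i, 0 < y i := fun i => sub_pos.2 (hlδ i)
  have hzpos : ∀ i, 0 < z i := fun i => add_pos (hu i) hδU
  set D := ∑ i, (y i)⁻¹ - ∑ i, (x i - l)⁻¹ with hDdef
  set E := ∑ i, (u - x i)⁻¹ - ∑ i, (z i)⁻¹ with hEdef
  have hDpos : 0 < D := sub_pos.2 hD
  have hEpos : 0 < E := sub_pos.2 hE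
  set R := conjDiag U fun i => (y i)⁻¹ with hR
  set Q := conjDiag U fun i => (z i)⁻¹ with hQ
  have hRR : R * R = conjDiag U fun i => (y i)⁻¹ * (y i)⁻¹ := conjDiag_mul hU _ _
  have hQQ : Q * Q = conjDiag U fun i => (z i)⁻¹ * (z i)⁻¹ := conjDiag_mul hU _ _
  have hsum : ∑ i, c i * (reForm (Q * Q) (v i) / E + reForm Q (v i)) ≤
      ∑ i, c i * (reForm (R * R) (v i) / D - reForm R (v i)) := by
    have h1 : ∑ i, c i * (reForm (Q * Q) (v i) / E + reForm Q (v i)) =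
        (∑ i, (z i)⁻¹ * (z i)⁻¹) / E + ∑ i, (z i)⁻¹ := by
      simp only [mul_add, ← mul_div_assoc]
      rw [Finset.sum_add_distrib, ← Finset.sum_div, sum_mul_reForm_eq_re_trace hv,
        sum_mul_reForm_eq_re_trace hv, hQQ, re_trace_conjDiag hU, re_trace_conjDiag hU]
    have h2 : ∑ i, c i * (reForm (R * R) (v i) / D - reForm R (v i)) =
        (∑ i, (y i)⁻¹ * (y i)⁻¹) / D - ∑ i, (y i)⁻¹ := by
      simp only [mul_sub, ← mul_div_assoc]
      rw [Finset.sum_sub_distrib, ← Finset.sum_div, sum_mul_reForm_eq_re_trace hv,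
        sum_mul_reForm_eq_re_trace hv, hRR, re_trace_conjDiag hU, re_trace_conjDiag hU]
    have h3 : (∑ i, (z i)⁻¹ * (z i)⁻¹) / E ≤ δU⁻¹ := by
      rw [div_le_iff₀ hEpos, mul_comm]; exact hE2
    have h4 : δL⁻¹ + D ≤ (∑ i, (y i)⁻¹ * (y i)⁻¹) / D := by
      rw [le_div_iff₀ hDpos, mul_comm]; exact hD2
    rw [h1, h2]
    linarith
  obtain ⟨i, hci, hvi, hle⟩ := exists_le_of_sum_mul_le hc hv
    (f := fun v => reForm (Q * Q) v / E + reForm Q v)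
    (g := fun v => reForm (R * R) v / D - reForm R v)
    (by simp [reForm_zero_right]) (by simp [reForm_zero_right]) hsum
  have hQ2pos : 0 < reForm (Q * Q) (v i) := by
    rw [hQQ]
    exact reForm_conjDiag_pos hU' (fun i => mul_pos (inv_pos.2 (hzpos i)) (inv_pos.2 (hzpos i))) hvi
  have hQpos : 0 < reForm Q (v i) :=
    reForm_conjDiag_pos hU' (fun i => inv_pos.2 (hzpos i)) hvi
  have hRpos : 0 < reForm R (v i) :=
    reForm_conjDiag_pos hU' (fun i => inv_pos.2 (hypos i)) hvi
  set q := reForm (Q * Q) (v i) / E + reForm Q (v i) with hq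
  have hqpos : 0 < q := add_pos (div_pos hQ2pos hEpos) hQpos
  have hsq : q⁻¹ * reForm Q (v i) < 1 := by
    rw [inv_mul_lt_iff₀ hqpos, mul_one, hq]
    linarith [div_pos hQ2pos hEpos]
  have hlow : conjDiag U x + q⁻¹ • rankOne (v i) - (l + δL) • 1 =
      conjDiag U y + q⁻¹ • rankOne (v i) := by
    rw [add_sub_right_comm, conjDiag_sub_smul_one hU']
    simp only [hy, sub_sub]
  have hupp : (u + δU) • 1 - (conjDiag U x + q⁻¹ • rankOne (v i)) =
      conjDiag U z + (-q⁻¹ : ℝ) • rankOne (v i) := by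
    rw [← sub_sub, smul_one_sub_conjDiag hU', neg_smul, ← sub_eq_add_neg]
    simp only [hz, sub_add_eq_add_sub]
  refine ⟨i, q⁻¹, hci, inv_pos.2 hqpos, ?_, ?_, ?_, ?_, ?_⟩
  · exact (conjDiag_isHermitian U x).add ((rankOne_isHermitian _).smul (IsSelfAdjoint.all _))
  · intro a ha
    rw [hlow, reForm_add, reForm_smul, reForm_rankOne]
    exact add_pos_of_pos_of_nonneg (reForm_conjDiag_pos hU' hypos ha)
      (mul_nonneg (inv_pos.2 hqpos).le (sq_nonneg _))
  · intro a ha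
    rw [hupp, reForm_add, reForm_smul, reForm_rankOne]
    have h1 := norm_dotProduct_sq_le_conjDiag hU' hzpos (v i) a
    have h2 := reForm_conjDiag_pos hU' hzpos ha
    have h3 := mul_le_mul_of_nonneg_left h1 (inv_pos.2 hqpos).le
    rw [← mul_assoc] at h3
    have h4 := mul_lt_mul_of_pos_right hsq h2
    linarith
  · have hk : 0 < 1 + q⁻¹ * reForm R (v i) := by positivity
    rw [hlow, re_trace_inv_add_smul_rankOne (conjDiag_mul_inv hU hU' fun i => (hypos i).ne')
      (conjDiag_isHermitian _ _) (v i) hk.ne', re_trace_conjDiag hU]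
    have h1 : D ≤ q⁻¹ / (1 + q⁻¹ * reForm R (v i)) * reForm (R * R) (v i) := by
      rw [div_mul_eq_mul_div, le_div_iff₀ hk]
      have h2 : D * (q + reForm R (v i)) ≤ reForm (R * R) (v i) := by
        rw [mul_comm, ← le_div_iff₀ hDpos]; linarith
      calc D * (1 + q⁻¹ * reForm R (v i)) = q⁻¹ * (D * (q + reForm R (v i))) := by field_simp
        _ ≤ _ := by gcongr
    linarith
  · have hk : 0 < 1 + -q⁻¹ * reForm Q (v i) := by linarith
    rw [hupp, re_trace_inv_add_smul_rankOne (conjDiag_mul_inv hU hU' fun i => (hzpos i).ne')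
      (conjDiag_isHermitian _ _) (v i) hk.ne', re_trace_conjDiag hU]
    have h1 : q⁻¹ / (1 + -q⁻¹ * reForm Q (v i)) * reForm (Q * Q) (v i) = E := by
      have h2 : reForm (Q * Q) (v i) = E * (q - reForm Q (v i)) := by
        rw [hq]; field_simp; ring
      rw [div_mul_eq_mul_div, div_eq_iff hk.ne', h2]
      field_simp
      ring
    rw [neg_div, neg_mul, h1]
    linarith

end BarrierMethod

section Sparsification

variable {d ι : Type*} [Fintype d] [DecidableEq d] [Fintype ι]

theorem exists_barrier_weights [Nonempty d] {c : ι → ℝ} {v : ι → d → ℂ} (hc : ∀ i, 0 ≤ c i)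
    (hv : ∑ i, c i • rankOne (v i) = 1) {l u εL εU δL δU : ℝ}
    (h0 : IsBarrierState (0 : Matrix d d ℂ) l u εL εU) (hδL : 0 < δL) (hδU : 0 < δU)
    (hεL : εL < δL⁻¹) (hbal : δU⁻¹ + εU ≤ δL⁻¹ - εL) (N : ℕ) :
    ∃ w : ι → ℝ, (∀ i, 0 ≤ w i) ∧ (Finset.univ.filter fun i => w i ≠ 0).card ≤ N ∧
      (∀ i, w i ≠ 0 → 0 < c i) ∧
      IsBarrierState (∑ i, w i • rankOne (v i)) (l + N * δL) (u + N * δU) εL εU := by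
  classical
  induction N with
  | zero => exact ⟨0, by simp, by simp, by simp, by simpa using h0⟩
  | succ N ih =>
    obtain ⟨w, hw, hcard, hsupp, hstate⟩ := ih
    obtain ⟨i, s, hi, hs, hstep⟩ := exists_barrier_step hc hv hstate hδL hδU hεL hbal
    refine ⟨w + Pi.single i s, fun k => ?_, ?_, fun k hk => ?_, ?_⟩
    · have hk : (0 : ι → ℝ) k ≤ (Pi.single i s : ι → ℝ) k := Pi.single_nonneg.2 hs.le k
      exact add_nonneg (hw k) hk
    · have hsub : (Finset.univ.filter fun k => (w + Pi.single i s : ι → ℝ) k ≠ 0) ⊆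
          insert i (Finset.univ.filter fun k => w k ≠ 0) := by
        intro k hk
        by_cases hki : k = i
        · simp [hki]
        · simpa [hki] using hk
      exact (Finset.card_le_card hsub).trans ((Finset.card_insert_le _ _).trans (by lia))
    · by_cases hki : k = i
      · rwa [hki]
      · exact hsupp k (by simpa [hki] using hk)
    · convert hstep using 1
      · simp only [Pi.add_apply, add_smul, Finset.sum_add_distrib]
        congr 1
        rw [Finset.sum_eq_single i] <;> simp +contextual
      · push_cast; ring
      · push_cast; ring

theorem isBarrierState_zero [Nonempty d] {εL εU : ℝ} (hL : 0 < εL) (hU : 0 < εU) :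
    IsBarrierState (0 : Matrix d d ℂ) (-(Fintype.card d / εL)) (Fintype.card d / εU) εL εU := by
  have hcard : (0 : ℝ) < Fintype.card d := Nat.cast_pos.2 Fintype.card_pos
  have hpos : ∀ r : ℝ, 0 < r → ∀ a : d → ℂ, a ≠ 0 → 0 < reForm (r • 1) a := fun r hr a ha => by
    rw [reForm_smul, reForm_one]
    exact mul_pos hr (sum_norm_sq_pos ha)
  have htrace : ∀ ε : ℝ, 0 < ε →
      ((Fintype.card d / ε : ℝ) • (1 : Matrix d d ℂ))⁻¹.trace.re = ε := fun ε hε => by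
    have hinv : ((Fintype.card d / ε : ℝ) • (1 : Matrix d d ℂ))⁻¹ =
        (Fintype.card d / ε : ℝ)⁻¹ • 1 := by
      refine inv_eq_right_inv ?_
      rw [smul_mul_smul_comm, mul_one, mul_inv_cancel₀ (div_pos hcard hε).ne', one_smul]
    rw [hinv, re_trace_smul, trace_one, Complex.natCast_re]
    field_simp
  have hlow : (0 : Matrix d d ℂ) - (-(Fintype.card d / εL) : ℝ) • (1 : Matrix d d ℂ) =
      (Fintype.card d / εL : ℝ) • 1 := by
    rw [neg_smul, zero_sub, neg_neg]
  refine ⟨isHermitian_zero, ?_, ?_, ?_, ?_⟩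
  · rw [hlow]; exact hpos _ (div_pos hcard hL)
  · rw [sub_zero]; exact hpos _ (div_pos hcard hU)
  · rw [hlow, htrace _ hL]
  · rw [sub_zero, htrace _ hU]

/-- Spectral sparsification of a decomposition of the identity, with the optimal ratio of the
barrier method. -/
theorem exists_sparse_weights_of_sum_eq_one [Nonempty d] {c : ι → ℝ} {v : ι → d → ℂ}
    (hc : ∀ i, 0 ≤ c i) (hv : ∑ i, c i • rankOne (v i) = 1) {q : ℝ} (hq : 1 < q) {N : ℕ}
    (hN : (N : ℝ) = q ^ 2 * Fintype.card d) :
    ∃ w : ι → ℝ, (∀ i, 0 ≤ w i) ∧ (Finset.univ.filter fun i => w i ≠ 0).card ≤ N ∧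
      (∀ i, w i ≠ 0 → 0 < c i) ∧ ∀ a : d → ℂ,
        ((q - 1) / (q + 1)) ^ 2 * ∑ i, ‖a i‖ ^ 2 ≤ ∑ i, w i * ‖star (v i) ⬝ᵥ a‖ ^ 2 ∧
        ∑ i, w i * ‖star (v i) ⬝ᵥ a‖ ^ 2 ≤ ∑ i, ‖a i‖ ^ 2 := by
  have hcard : (0 : ℝ) < Fintype.card d := Nat.cast_pos.2 Fintype.card_pos
  have hq0 : 0 < q := by linarith
  have hq1 : 0 < q - 1 := by linarith
  obtain ⟨w, hw, hwN, hsupp, hstate⟩ := exists_barrier_weights hc hv (δL := 1)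
    (δU := (q + 1) / (q - 1)) (isBarrierState_zero (d := d) (εL := q⁻¹)
      (εU := (q - 1) / (q * (q + 1))) (by positivity) (by positivity))
    one_pos (by positivity) (by rw [inv_one]; exact inv_lt_one_of_one_lt₀ hq)
    (le_of_eq (by field_simp)) N
  have hl : -(Fintype.card d / q⁻¹) + N * 1 = Fintype.card d * q * (q - 1) := by
    rw [hN]; field_simp; ring
  have hu : Fintype.card d / ((q - 1) / (q * (q + 1))) + N * ((q + 1) / (q - 1)) =
      Fintype.card d * q * (q + 1) ^ 2 / (q - 1) := by
    rw [hN]; field_simp; ring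
  rw [hl, hu] at hstate
  set K := (Fintype.card d : ℝ) * q * (q + 1) ^ 2 / (q - 1) with hK
  have hKpos : 0 < K := by positivity
  have hform : ∀ a, reForm (∑ i, w i • rankOne (v i)) a =
      ∑ i, w i * ‖star (v i) ⬝ᵥ a‖ ^ 2 := fun a => by
    simp only [reForm_sum, reForm_smul, reForm_rankOne]
  refine ⟨fun i => w i / K, fun i => div_nonneg (hw i) hKpos.le, ?_, fun i hi => ?_, fun a => ?_⟩
  · simpa [hKpos.ne'] using hwN
  · exact hsupp i fun h => hi (by simp [h])
  · have hsum : ∑ i, w i / K * ‖star (v i) ⬝ᵥ a‖ ^ 2 =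
        (∑ i, w i * ‖star (v i) ⬝ᵥ a‖ ^ 2) / K := by
      rw [Finset.sum_div]
      exact Finset.sum_congr rfl fun i _ => by ring
    rw [hsum, le_div_iff₀ hKpos, div_le_iff₀ hKpos]
    by_cases ha : a = 0
    · simp [ha]
    · have h1 := hstate.lower_pos a ha
      have h2 := hstate.upper_pos a ha
      rw [reForm_sub, reForm_smul, reForm_one, hform] at h1 h2
      have h3 : ((q - 1) / (q + 1)) ^ 2 * K = Fintype.card d * q * (q - 1) := by
        rw [hK]; field_simp
      refine ⟨?_, by linarith⟩
      rw [mul_right_comm, h3]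
      linarith

theorem sum_norm_sq_mulVec {d : Type*} [Fintype d] {H : Matrix d d ℂ} (hH : H.IsHermitian) (a : d → ℂ) :
    ∑ i, ‖(H *ᵥ a) i‖ ^ 2 = reForm (H * H) a := by
  rw [← star_dotProduct_self_re, star_mulVec, hH.eq, ← dotProduct_mulVec, mulVec_mulVec, reForm]

theorem rankOne_mulVec {d : Type*} [Fintype d] {H : Matrix d d ℂ} (hH : H.IsHermitian) (v : d → ℂ) :
    rankOne (H *ᵥ v) = H * rankOne v * H := by
  rw [rankOne, rankOne, mul_vecMulVec, vecMulVec_mul, star_mulVec, hH.eq]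

/-- Spectral sparsification of a frame. -/
theorem exists_sparse_weights [Nonempty d] {c : ι → ℝ} {v : ι → d → ℂ}
    (hc : ∀ i, 0 ≤ c i) {α : ℝ} (hα : 0 < α)
    (hlow : ∀ a : d → ℂ, α * ∑ i, ‖a i‖ ^ 2 ≤ ∑ i, c i * ‖star (v i) ⬝ᵥ a‖ ^ 2)
    {q : ℝ} (hq : 1 < q) {N : ℕ} (hN : (N : ℝ) = q ^ 2 * Fintype.card d) :
    ∃ w : ι → ℝ, (∀ i, 0 ≤ w i) ∧ (Finset.univ.filter fun i => w i ≠ 0).card ≤ N ∧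
      (∀ i, w i ≠ 0 → 0 < c i) ∧ ∀ a : d → ℂ,
        ((q - 1) / (q + 1)) ^ 2 * ∑ i, c i * ‖star (v i) ⬝ᵥ a‖ ^ 2 ≤
          ∑ i, w i * ‖star (v i) ⬝ᵥ a‖ ^ 2 ∧
        ∑ i, w i * ‖star (v i) ⬝ᵥ a‖ ^ 2 ≤ ∑ i, c i * ‖star (v i) ⬝ᵥ a‖ ^ 2 := by
  have hform : ∀ a, reForm (∑ i, c i • rankOne (v i)) a =
      ∑ i, c i * ‖star (v i) ⬝ᵥ a‖ ^ 2 := fun a => by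
    simp only [reForm_sum, reForm_smul, reForm_rankOne]
  have hherm : (∑ i, c i • rankOne (v i)).IsHermitian := by
    rw [IsHermitian, conjTranspose_sum]
    refine Finset.sum_congr rfl fun i _ => ?_
    exact (rankOne_isHermitian _).smul (IsSelfAdjoint.all _)
  obtain ⟨U, f, hU, hU', hS⟩ := exists_diagonalization hherm
  change _ = conjDiag U f at hS
  have hf : ∀ i, 0 < f i := pos_of_reForm_conjDiag_pos hU fun a ha => by
    rw [← hS, hform]
    exact (mul_pos hα (sum_norm_sq_pos ha)).trans_le (hlow a)
  have hsf : ∀ i, √(f i) ≠ 0 := fun i => (Real.sqrt_pos.2 (hf i)).ne'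
  set B := conjDiag U fun i => √(f i) with hB
  set T := conjDiag U fun i => (√(f i))⁻¹ with hT
  have hTherm : T.IsHermitian := conjDiag_isHermitian _ _
  have hBT : B * T = 1 := conjDiag_mul_inv hU hU' hsf
  have hTB : T * B = 1 := mul_eq_one_comm.1 hBT
  have hBB : B * B = conjDiag U f := by
    rw [hB, conjDiag_mul hU]
    simp only [Real.mul_self_sqrt (hf _).le]
  have hone : ∑ i, c i • rankOne (T *ᵥ v i) = 1 := by
    have h : ∀ i, c i • rankOne (T *ᵥ v i) = T * (c i • rankOne (v i)) * T := fun i => by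
      rw [rankOne_mulVec hTherm, mul_smul_comm, smul_mul_assoc]
    simp only [h]
    rw [← Matrix.sum_mul, ← Matrix.mul_sum, hS, ← hBB, ← mul_assoc, hTB, one_mul, hBT]
  obtain ⟨w, hw, hwN, hsupp, hwa⟩ := exists_sparse_weights_of_sum_eq_one hc hone hq hN
  refine ⟨w, hw, hwN, hsupp, fun a => ?_⟩
  have h := hwa (B *ᵥ a)
  have hdot : ∀ i, star (T *ᵥ v i) ⬝ᵥ (B *ᵥ a) = star (v i) ⬝ᵥ a := fun i => by
    rw [star_mulVec, hTherm.eq, ← dotProduct_mulVec, mulVec_mulVec, hTB, one_mulVec]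
  have hnorm : ∑ i, ‖(B *ᵥ a) i‖ ^ 2 = ∑ i, c i * ‖star (v i) ⬝ᵥ a‖ ^ 2 := by
    rw [sum_norm_sq_mulVec (conjDiag_isHermitian U _), hBB, ← hS, hform]
  simpa only [hdot, hnorm] using h

/-- A frame of unit vectors contains a well-conditioned unweighted subframe of small
cardinality. -/
theorem exists_subset_lower_frame_bound [Nonempty d] {c : ι → ℝ} {v : ι → d → ℂ}
    (hc : ∀ i, 0 ≤ c i) (hunit : ∀ i, ∑ k, ‖v i k‖ ^ 2 = 1) {α β : ℝ} (hα : 0 < α) (hβ : 0 < β)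
    (hlow : ∀ a : d → ℂ, α * ∑ i, ‖a i‖ ^ 2 ≤ ∑ i, c i * ‖star (v i) ⬝ᵥ a‖ ^ 2)
    (hupp : ∀ a : d → ℂ, ∑ i, c i * ‖star (v i) ⬝ᵥ a‖ ^ 2 ≤ β * ∑ i, ‖a i‖ ^ 2)
    {q : ℝ} (hq : 1 < q) {N : ℕ} (hN : (N : ℝ) = q ^ 2 * Fintype.card d) :
    ∃ J : Finset ι, (∀ i ∈ J, 0 < c i) ∧ J.card ≤ N ∧ ∀ a : d → ℂ,
      ((q - 1) / (q + 1)) ^ 2 * (α / β) * ∑ i, ‖a i‖ ^ 2 ≤ ∑ i ∈ J, ‖star (v i) ⬝ᵥ a‖ ^ 2 := by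
  obtain ⟨w, hw, hwN, hsupp, hwa⟩ := exists_sparse_weights hc hα hlow hq hN
  refine ⟨Finset.univ.filter fun i => w i ≠ 0, fun i hi => hsupp i (Finset.mem_filter.1 hi).2,
    hwN, fun a => ?_⟩
  have hwβ : ∀ i, w i ≤ β := fun i => by
    have h1 : ‖star (v i) ⬝ᵥ v i‖ ^ 2 = 1 := by
      have him : (star (v i) ⬝ᵥ v i).im = 0 := by simp [dotProduct, mul_comm]
      rw [← Complex.normSq_eq_norm_sq, Complex.normSq_apply, star_dotProduct_self_re, hunit, him]
      norm_num
    have h3 := (hwa (v i)).2.trans (hupp (v i))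
    rw [hunit, mul_one] at h3
    refine le_trans ?_ h3
    have h4 := Finset.single_le_sum (f := fun k => w k * ‖star (v k) ⬝ᵥ v i‖ ^ 2)
      (fun k _ => mul_nonneg (hw k) (sq_nonneg _)) (Finset.mem_univ i)
    simpa only [h1, mul_one] using h4
  have hsum : ∑ i, w i * ‖star (v i) ⬝ᵥ a‖ ^ 2 ≤
      β * ∑ i with w i ≠ 0, ‖star (v i) ⬝ᵥ a‖ ^ 2 := by
    rw [Finset.mul_sum, Finset.sum_filter]
    refine Finset.sum_le_sum fun i _ => ?_
    split_ifs with h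
    · exact mul_le_mul_of_nonneg_right (hwβ i) (sq_nonneg _)
    · simp [not_not.1 h]
  have h5 := mul_le_mul_of_nonneg_left (hlow a) (sq_nonneg ((q - 1) / (q + 1)))
  have h6 := (h5.trans (hwa a).1).trans hsum
  rw [← mul_div_assoc, div_mul_eq_mul_div, div_le_iff₀ hβ]
  linarith

end Sparsification

section Concentration

variable {d ι : Type*} [Fintype d] [Fintype ι]

theorem upper_tail_exponent_le {t s : ℝ} (ht : 0 < t) (ht1 : t < 1) (hs : 0 ≤ s) :
    t * s - (1 + t) * s * Real.log (1 + t) ≤ -(t ^ 2 * s / 3) := by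
  have h1 := Real.le_log_one_add_of_nonneg ht.le
  have h2 : t + t ^ 2 / 3 ≤ (1 + t) * (2 * t / (t + 2)) := by
    rw [← mul_div_assoc, le_div_iff₀ (by linarith)]
    nlinarith [mul_pos ht ht, mul_pos (mul_pos ht ht) (sub_pos.2 ht1)]
  have h3 : t + t ^ 2 / 3 ≤ (1 + t) * Real.log (1 + t) := h2.trans (by gcongr)
  nlinarith [mul_le_mul_of_nonneg_right h3 hs]

theorem lower_tail_exponent_lt {t s : ℝ} (ht : 0 < t) (ht1 : t < 1) (hs : 0 < s) :
    (Real.exp (-t) - 1) * s + t * ((1 - t) * s) < -(t ^ 2 * s / 3) := by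
  have h1 : Real.exp (-t) ≤ 1 - t + t ^ 2 / 2 := by
    rw [Real.exp_neg]
    refine inv_le_of_inv_le₀ (by nlinarith) (le_trans ?_ (Real.quadratic_le_exp_of_nonneg ht.le))
    rw [inv_le_iff_one_le_mul₀ (by nlinarith)]
    nlinarith [sq_nonneg (t ^ 2)]
  nlinarith [mul_le_mul_of_nonneg_right h1 hs.le, mul_pos (pow_pos ht 2) hs]

open Classical in
/-- Sampling a tight frame of unit vectors gives a well-conditioned frame with high
probability. -/
theorem one_sub_lt_sum_prod_filter [DecidableEq d] [Nonempty d] {ρ : ι → ℝ} {v : ι → d → ℂ}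
    (hρ : ∀ i, 0 ≤ ρ i) (hsum : ∑ i, ρ i = 1) (hv : ∀ i, ∑ k, ‖v i k‖ ^ 2 = 1)
    (hmean : ∑ i, ρ i • rankOne (v i) = (Fintype.card d : ℝ)⁻¹ • 1) {p t : ℝ} (hp : 0 < p)
    (ht : 0 < t) (ht1 : t < 1) {n : ℕ} (hn0 : 0 < n)
    (hn : 3 / t ^ 2 * Fintype.card d * Real.log (2 * Fintype.card d / p) ≤ n) :
    1 - p < ∑ j : Fin n → ι with ∀ a : d → ℂ,
      (1 - t) * (n / Fintype.card d) * ∑ i, ‖a i‖ ^ 2 ≤ ∑ k, ‖star (v (j k)) ⬝ᵥ a‖ ^ 2 ∧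
      ∑ k, ‖star (v (j k)) ⬝ᵥ a‖ ^ 2 ≤ (1 + t) * (n / Fintype.card d) * ∑ i, ‖a i‖ ^ 2,
      ∏ k, ρ (j k) := by
  have hcard : (0 : ℝ) < Fintype.card d := Nat.cast_pos.2 Fintype.card_pos
  have hcard1 : (1 : ℝ) ≤ Fintype.card d := Nat.one_le_cast.2 Fintype.card_pos
  have hform : ∀ (j : Fin n → ι) (a : d → ℂ), reForm (∑ k, rankOne (v (j k))) a =
      ∑ k, ‖star (v (j k)) ⬝ᵥ a‖ ^ 2 := fun j a => by
    simp only [reForm_sum, reForm_rankOne]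
  set s : ℝ := n / Fintype.card d with hs
  have hspos : 0 < s := div_pos (Nat.cast_pos.2 hn0) hcard
  have htail := fun r c => sum_prod_filter_le_of_mean hρ hsum (fun i => rankOne_isHermitian (v i))
    (fun i => rankOne_mul_self (hv i)) (inv_le_one_of_one_le₀ hcard1) (inv_pos.2 hcard).le
    hmean r c n
  have hexp : Fintype.card d * Real.exp (-(t ^ 2 * s / 3)) ≤ p / 2 := by
    have h1 : Real.log (2 * Fintype.card d / p) ≤ t ^ 2 * s / 3 := by
      rw [hs, le_div_iff₀ three_pos, ← mul_div_assoc, le_div_iff₀ hcard]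
      calc Real.log (2 * Fintype.card d / p) * 3 * Fintype.card d
          = t ^ 2 * (3 / t ^ 2 * Fintype.card d * Real.log (2 * Fintype.card d / p)) := by
            field_simp
        _ ≤ t ^ 2 * n := by gcongr
    have h2 : Real.exp (-(t ^ 2 * s / 3)) ≤ p / (2 * Fintype.card d) := by
      calc Real.exp (-(t ^ 2 * s / 3)) ≤ Real.exp (-Real.log (2 * Fintype.card d / p)) := by
            gcongr
        _ = p / (2 * Fintype.card d) := by
            rw [Real.exp_neg, Real.exp_log (by positivity), inv_div]
    calc Fintype.card d * Real.exp (-(t ^ 2 * s / 3))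
        ≤ Fintype.card d * (p / (2 * Fintype.card d)) := by gcongr
      _ = p / 2 := by field_simp
  have hupp := htail (Real.log (1 + t)) ((1 + t) * s * Real.log (1 + t))
  have hlow := htail (-t) (-(t * ((1 - t) * s)))
  have hupp' : (Fintype.card d : ℝ) * Real.exp ((Real.exp (Real.log (1 + t)) - 1) *
      (Fintype.card d : ℝ)⁻¹ * n - (1 + t) * s * Real.log (1 + t)) ≤ p / 2 := by
    refine le_trans ?_ hexp
    gcongr
    refine le_trans (le_of_eq ?_) (upper_tail_exponent_le ht ht1 hspos.le)
    rw [Real.exp_log (by linarith), hs]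
    field_simp
    ring
  have hlow' : (Fintype.card d : ℝ) * Real.exp ((Real.exp (-t) - 1) *
      (Fintype.card d : ℝ)⁻¹ * n - -(t * ((1 - t) * s))) < p / 2 := by
    refine lt_of_lt_of_le ?_ hexp
    gcongr
    refine lt_of_eq_of_lt ?_ (lower_tail_exponent_lt ht ht1 hspos)
    rw [hs]
    field_simp
    ring
  have hw : ∀ j : Fin n → ι, 0 ≤ ∏ k, ρ (j k) := fun j => Finset.prod_nonneg fun k _ => hρ _
  have htotal : ∑ j : Fin n → ι, ∏ k, ρ (j k) = 1 := by
    rw [← Fintype.sum_pow, hsum, one_pow]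
  set good : (Fin n → ι) → Prop := fun j => ∀ a : d → ℂ,
      (1 - t) * s * ∑ i, ‖a i‖ ^ 2 ≤ ∑ k, ‖star (v (j k)) ⬝ᵥ a‖ ^ 2 ∧
      ∑ k, ‖star (v (j k)) ⬝ᵥ a‖ ^ 2 ≤ (1 + t) * s * ∑ i, ‖a i‖ ^ 2 with hgood
  have hsplit := Finset.sum_filter_add_sum_filter_not Finset.univ good fun j => ∏ k, ρ (j k)
  have hbad : ∑ j with ¬ good j, ∏ k, ρ (j k) ≤
      (∑ j : Fin n → ι with ¬ ∀ a, Real.log (1 + t) * reForm (∑ k, rankOne (v (j k))) a ≤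
        (1 + t) * s * Real.log (1 + t) * ∑ i, ‖a i‖ ^ 2, ∏ k, ρ (j k)) +
      ∑ j : Fin n → ι with ¬ ∀ a, -t * reForm (∑ k, rankOne (v (j k))) a ≤
        -(t * ((1 - t) * s)) * ∑ i, ‖a i‖ ^ 2, ∏ k, ρ (j k) := by
    rw [← Finset.sum_union_inter]
    refine le_trans ?_ (le_add_of_nonneg_right (Finset.sum_nonneg fun j _ => hw j))
    refine Finset.sum_le_sum_of_subset_of_nonneg (fun j hj => ?_) fun j _ _ => hw j
    rw [← Finset.filter_or, Finset.mem_filter]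
    refine ⟨Finset.mem_univ j, ?_⟩
    by_contra! h
    refine (Finset.mem_filter.1 hj).2 fun a => ⟨?_, ?_⟩
    · have h1 := h.2 a
      rw [hform] at h1
      refine le_of_mul_le_mul_left ?_ ht
      linarith
    · have h1 := h.1 a
      rw [hform] at h1
      refine le_of_mul_le_mul_left ?_ (Real.log_pos (by linarith : 1 < 1 + t))
      linarith
  linarith

theorem ofReal_sum_prod_le_measure_pi {ι : Type*} [MeasurableSpace ι] [MeasurableSingletonClass ι]
    {ρ : ι → ℝ} (hρ : ∀ i, 0 ≤ ρ i) {μ : Measure ι} [IsProbabilityMeasure μ]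
    (hμ : ∀ i, μ {i} = ENNReal.ofReal (ρ i)) {n : ℕ} {F : Finset (Fin n → ι)}
    {s : Set (Fin n → ι)} (hF : ↑F ⊆ s) :
    ENNReal.ofReal (∑ j ∈ F, ∏ k, ρ (j k)) ≤ Measure.pi (fun _ : Fin n => μ) s := by
  refine le_trans (le_of_eq ?_) (measure_mono hF)
  rw [← sum_measure_singleton, ENNReal.ofReal_sum_of_nonneg
    fun j _ => Finset.prod_nonneg fun k _ => hρ _]
  refine Finset.sum_congr rfl fun j _ => ?_
  rw [Measure.pi_singleton, ENNReal.ofReal_prod_of_nonneg fun k _ => hρ _]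
  simp only [hμ]

end Concentration

section Subframe

variable {d ι : Type*} [Fintype d] [Fintype ι]

theorem sum_card_fiber_mul [DecidableEq ι] {n : ℕ} (j : Fin n → ι) (g : ι → ℝ) :
    ∑ i, ((Finset.univ.filter fun k => j k = i).card : ℝ) * g i = ∑ k, g (j k) := by
  simp only [Finset.card_filter, Nat.cast_sum, Finset.sum_mul]
  rw [Finset.sum_comm]
  simp

theorem cube_div_le_barrier_ratio {b q t : ℝ} (hb : 1 < b) (hbq : b ≤ q ^ 2) (hq : 1 < q)
    (ht : 0 < t) (ht1 : t < 1) {s : ℝ} (hs : 0 < s) :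
    (1 - t) * (b - 1) ^ 3 / (432 * b ^ 3) ≤
      ((q - 1) / (q + 1)) ^ 2 * ((1 - t) * s / ((1 + t) * s)) := by
  have hb0 : 0 < b := by linarith
  set z := (b - 1) / b with hz
  have hz0 : 0 < z := div_pos (by linarith) hb0
  have hz1 : z < 1 := by rw [hz, div_lt_one hb0]; linarith
  have h1 : z / 4 ≤ (q - 1) / (q + 1) := by
    rw [hz, div_div, div_le_div_iff₀ (by positivity) (by linarith)]
    have hcube : 0 ≤ (q - 1) ^ 2 * (3 * q + 1) := by positivity
    rcases le_total (5 - 3 * q) 0 with h | h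
    · nlinarith [mul_nonpos_of_nonneg_of_nonpos hb0.le h]
    · nlinarith [mul_le_mul_of_nonneg_right hbq h]
  have h2 : (1 - t) / 2 ≤ (1 - t) * s / ((1 + t) * s) := by
    rw [mul_div_mul_right _ _ hs.ne']
    exact div_le_div_of_nonneg_left (by linarith) (by linarith) (by linarith)
  have h3 : (0 : ℝ) ≤ 1 - t := by linarith
  calc (1 - t) * (b - 1) ^ 3 / (432 * b ^ 3) = (1 - t) * z ^ 2 * z / 432 := by
        rw [hz]; field_simp
    _ ≤ (1 - t) * z ^ 2 * 1 / 32 := by gcongr; norm_num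
    _ = (z / 4) ^ 2 * ((1 - t) / 2) := by ring
    _ ≤ _ := by gcongr

/-- A sample of unit vectors with good frame bounds contains a well-conditioned subframe of at
most `⌈b m⌉` distinct vectors. -/
theorem exists_subset_range_frame_bounds [DecidableEq d] [Nonempty d] {v : ι → d → ℂ}
    (hv : ∀ i, ∑ k, ‖v i k‖ ^ 2 = 1) {t s b : ℝ} (ht : 0 < t) (ht1 : t < 1) (hs : 0 < s)
    (hb : 1 < b) {n : ℕ} {j : Fin n → ι}
    (hj : ∀ a : d → ℂ, (1 - t) * s * ∑ i, ‖a i‖ ^ 2 ≤ ∑ k, ‖star (v (j k)) ⬝ᵥ a‖ ^ 2 ∧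
      ∑ k, ‖star (v (j k)) ⬝ᵥ a‖ ^ 2 ≤ (1 + t) * s * ∑ i, ‖a i‖ ^ 2) :
    ∃ J : Finset ι, ↑J ⊆ Set.range j ∧ J.card ≤ ⌈b * Fintype.card d⌉₊ ∧ ∀ a : d → ℂ,
      (1 - t) * (b - 1) ^ 3 / (432 * b ^ 3) * ∑ i, ‖a i‖ ^ 2 ≤
        ∑ i ∈ J, ‖star (v i) ⬝ᵥ a‖ ^ 2 ∧
      ∑ i ∈ J, ‖star (v i) ⬝ᵥ a‖ ^ 2 ≤ (1 + t) * s * ∑ i, ‖a i‖ ^ 2 := by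
  classical
  have hcard : (0 : ℝ) < Fintype.card d := Nat.cast_pos.2 Fintype.card_pos
  set N := ⌈b * Fintype.card d⌉₊ with hNdef
  set c : ι → ℝ := fun i => (Finset.univ.filter fun k => j k = i).card with hc
  have hfib : ∀ a : d → ℂ, ∑ i, c i * ‖star (v i) ⬝ᵥ a‖ ^ 2 = ∑ k, ‖star (v (j k)) ⬝ᵥ a‖ ^ 2 :=
    fun a => sum_card_fiber_mul j fun i => ‖star (v i) ⬝ᵥ a‖ ^ 2
  set q := √(N / Fintype.card d) with hq
  have hq2 : q ^ 2 = N / Fintype.card d := Real.sq_sqrt (by positivity)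
  have hbq : b ≤ q ^ 2 := by
    rw [hq2, le_div_iff₀ hcard]
    exact Nat.le_ceil _
  have hq1 : 1 < q := by
    rw [hq, Real.lt_sqrt one_pos.le, ← hq2]
    linarith
  obtain ⟨J, hJpos, hJcard, hJlow⟩ := exists_subset_lower_frame_bound (c := c)
    (α := (1 - t) * s) (β := (1 + t) * s) (fun i => Nat.cast_nonneg _) hv
    (mul_pos (by linarith) hs) (mul_pos (by linarith) hs) (fun a => by rw [hfib]; exact (hj a).1)
    (fun a => by rw [hfib]; exact (hj a).2) hq1 (N := N) (by rw [hq2]; field_simp)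
  have hJone : ∀ i ∈ J, 1 ≤ c i := fun i hi => Nat.one_le_cast.2 (Nat.cast_pos.1 (hJpos i hi))
  refine ⟨J, fun i hi => ?_, hJcard, fun a => ⟨?_, ?_⟩⟩
  · obtain ⟨k, hk⟩ := Finset.card_pos.1 (Nat.cast_pos.1 (hJpos i hi))
    exact ⟨k, (Finset.mem_filter.1 hk).2⟩
  · refine le_trans ?_ (hJlow a)
    gcongr
    exact cube_div_le_barrier_ratio hb hbq hq1 ht ht1 hs
  · refine le_trans ?_ (hj a).2
    rw [← hfib]
    calc ∑ i ∈ J, ‖star (v i) ⬝ᵥ a‖ ^ 2 ≤ ∑ i ∈ J, c i * ‖star (v i) ⬝ᵥ a‖ ^ 2 :=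
          Finset.sum_le_sum fun i hi => le_mul_of_one_le_left (sq_nonneg _) (hJone i hi)
      _ ≤ _ := Finset.sum_le_univ_sum_of_nonneg fun i =>
          mul_nonneg (Nat.cast_nonneg _) (sq_nonneg _)

theorem sum_sum_norm_sq_of_tight [DecidableEq d] {y : ι → d → ℂ} {A : ℝ}
    (htight : ∀ a : d → ℂ, ∑ i, ‖star (y i) ⬝ᵥ a‖ ^ 2 = A * ∑ j, ‖a j‖ ^ 2) :
    ∑ i, ∑ j, ‖y i j‖ ^ 2 = A * Fintype.card d := by
  rw [Finset.sum_comm]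
  have h : ∀ j, ∑ i, ‖y i j‖ ^ 2 = A := fun j => by
    have h1 := htight (Pi.single j 1)
    have h2 : ∑ k, ‖(Pi.single j 1 : d → ℂ) k‖ ^ 2 = 1 := by
      rw [Finset.sum_eq_single j] <;> simp +contextual
    simpa [h2] using h1
  simp [h, mul_comm]

end Subframe

/-- Two-step random + BSS subsampling producing a well-conditioned unit-norm
subframe of a tight frame (final Corollary of Section 4). -/
theorem stmt_15 (m M : ℕ) (hm : 10 ≤ m) (y : Fin M → Fin m → ℂ)
    (hy : ∀ i, y i ≠ 0) (A : ℝ) (hA : 0 < A)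
    (htight : ∀ a : Fin m → ℂ,
      ∑ i, ‖star (y i) ⬝ᵥ a‖ ^ 2 = A * ∑ j, ‖a j‖ ^ 2)
    (b' : ℝ) (hb' : 1 + 10 / (m : ℝ) ≤ b') (hM : ⌈b' * m⌉₊ ≤ M)
    (p t : ℝ) (hp : 0 < p) (hp1 : p < 1) (ht : 0 < t) (ht1 : t < 1)
    (n : ℕ) (hn : n = ⌈3 / t ^ 2 * m * Real.log (2 * m / p)⌉₊)
    (ρ : Fin M → ℝ)
    (hρ : ∀ i, ρ i = (∑ j, ‖y i j‖ ^ 2) / ∑ k, ∑ j, ‖y k j‖ ^ 2)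
    (μ : Measure (Fin M)) [IsProbabilityMeasure μ]
    (hμ : ∀ i, μ {i} = ENNReal.ofReal (ρ i)) :
    ENNReal.ofReal (1 - p) <
      Measure.pi (fun _ : Fin n => μ)
        {j : Fin n → Fin M | ∃ J' : Finset (Fin M),
          ↑J' ⊆ Set.range j ∧ J'.card ≤ ⌈b' * m⌉₊ ∧
          ∀ a : Fin m → ℂ,
            (1 - t) * (b' - 1) ^ 3 / (432 * b' ^ 3) * ∑ jj, ‖a jj‖ ^ 2 ≤
              ∑ i ∈ J', ‖star (y i) ⬝ᵥ a‖ ^ 2 / (∑ jj, ‖y i jj‖ ^ 2) ∧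
            ∑ i ∈ J', ‖star (y i) ⬝ᵥ a‖ ^ 2 / (∑ jj, ‖y i jj‖ ^ 2) ≤
              (1 + t) * (⌈3 * Real.log (2 * m / p) / t ^ 2⌉₊ : ℝ) *
                ∑ jj, ‖a jj‖ ^ 2} := by
  classical
  have hmpos : (0 : ℝ) < m := by positivity
  have : Nonempty (Fin m) := ⟨⟨0, by lia⟩⟩
  have hypos : ∀ i, 0 < ∑ j, ‖y i j‖ ^ 2 := fun i => sum_norm_sq_pos (hy i)
  have hZ := sum_sum_norm_sq_of_tight htight
  rw [Fintype.card_fin] at hZ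
  have hZpos : 0 < A * m := mul_pos hA hmpos
  rw [hZ] at hρ
  have hρ0 : ∀ i, 0 ≤ ρ i := fun i => by rw [hρ]; exact (div_pos (hypos i) hZpos).le
  have hρsum : ∑ i, ρ i = 1 := by
    simp only [hρ]
    rw [← Finset.sum_div, hZ, div_self hZpos.ne']
  set v : Fin M → Fin m → ℂ := fun i => (√(∑ j, ‖y i j‖ ^ 2))⁻¹ • y i with hv
  have hvdot : ∀ i a, ‖star (v i) ⬝ᵥ a‖ ^ 2 =
      ‖star (y i) ⬝ᵥ a‖ ^ 2 / ∑ j, ‖y i j‖ ^ 2 := fun i a => by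
    rw [hv, star_smul, smul_dotProduct, norm_smul, mul_pow, star_trivial, norm_inv, inv_pow,
      Real.norm_eq_abs, sq_abs, Real.sq_sqrt (hypos i).le, inv_mul_eq_div]
  have hvunit : ∀ i, ∑ k, ‖v i k‖ ^ 2 = 1 := fun i => by
    simp only [hv, Pi.smul_apply, norm_smul, mul_pow, norm_inv, inv_pow, Real.norm_eq_abs, sq_abs,
      Real.sq_sqrt (hypos i).le]
    rw [← Finset.mul_sum, inv_mul_cancel₀ (hypos i).ne']
  have hmean : ∑ i, ρ i • rankOne (v i) = (Fintype.card (Fin m) : ℝ)⁻¹ • 1 := by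
    refine eq_smul_one_of_reForm ?_ fun a => ?_
    · rw [IsHermitian, conjTranspose_sum]
      exact Finset.sum_congr rfl fun i _ => (rankOne_isHermitian _).smul (IsSelfAdjoint.all _)
    · have h : ∀ i, ρ i * (‖star (y i) ⬝ᵥ a‖ ^ 2 / ∑ j, ‖y i j‖ ^ 2) =
          ‖star (y i) ⬝ᵥ a‖ ^ 2 / (A * m) := fun i => by
        have := (hypos i).ne'
        rw [hρ]
        field_simp
      simp only [reForm_sum, reForm_smul, reForm_rankOne, hvdot, h]
      rw [← Finset.sum_div, htight, Fintype.card_fin]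
      field_simp
  have hlog : 0 < Real.log (2 * m / p) := by
    refine Real.log_pos ((one_lt_div hp).2 ?_)
    have : (10 : ℝ) ≤ m := by exact_mod_cast hm
    linarith
  have hn0 : 0 < n := by rw [hn]; exact Nat.ceil_pos.2 (by positivity)
  have hb1 : 1 < b' := lt_of_lt_of_le (lt_add_of_pos_right 1 (by positivity)) hb'
  have hnm : (n / m : ℝ) ≤ ⌈3 * Real.log (2 * m / p) / t ^ 2⌉₊ := by
    rw [div_le_iff₀ hmpos, hn, ← Nat.cast_mul, Nat.cast_le]
    refine Nat.ceil_le.2 ?_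
    rw [Nat.cast_mul]
    calc 3 / t ^ 2 * m * Real.log (2 * m / p) = 3 * Real.log (2 * m / p) / t ^ 2 * m := by ring
      _ ≤ _ := by gcongr; exact Nat.le_ceil _
  have hprob := one_sub_lt_sum_prod_filter hρ0 hρsum hvunit hmean hp ht ht1 hn0
    (by rw [Fintype.card_fin, hn]; exact Nat.le_ceil _)
  refine lt_of_lt_of_le ((ENNReal.ofReal_lt_ofReal_iff_of_nonneg (by linarith)).2 hprob)
    (ofReal_sum_prod_le_measure_pi hρ0 hμ fun j hj => ?_)
  obtain ⟨J, hJ, hJcard, hJa⟩ := exists_subset_range_frame_bounds hvunit ht ht1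
    (s := n / Fintype.card (Fin m)) (by rw [Fintype.card_fin]; positivity) hb1
    (Finset.mem_filter.1 hj).2
  simp only [Fintype.card_fin, hvdot] at hJcard hJa
  refine ⟨J, hJ, hJcard, fun a => ⟨(hJa a).1, (hJa a).2.trans ?_⟩⟩
  gcongr
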